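/- arXiv:2305.02992 — 5 statements merged into one kernel-verified Lean document; each statement's English description precedes it below -/
import Mathlib

section
/- For every τ in the complex upper half-plane, the functions u(τ) and v(τ) satisfy the algebraic relation (1+u(τ))² (1+v(τ))² = u(τ)·v(τ). -/
open Real

/-- `siegelProd q a = ∏_{n ≥ 1, n ≡ ±a mod 15} (1 - qⁿ)`. -/
noncomputable def siegelProd (q : ℂ) (a : ℕ) : ℂ :=
  ∏' n : ℕ, (if (n + 1) % 15 = a ∨ (n + 1) % 15 = 15 - a then 1 - q ^ (n + 1) else 1)

/-- The modular unit `u(τ) = -u₁(1,2,3,7) ∘ W₁₅`, expressed via Siegel units. -/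
noncomputable def unitU (τ : ℂ) : ℂ :=
  -((siegelProd (Complex.exp (2 * (π : ℂ) * Complex.I * τ)) 2 *
      siegelProd (Complex.exp (2 * (π : ℂ) * Complex.I * τ)) 4) /
    (siegelProd (Complex.exp (2 * (π : ℂ) * Complex.I * τ)) 1 *
      siegelProd (Complex.exp (2 * (π : ℂ) * Complex.I * τ)) 7))

/-- The modular unit `v(τ) = -u₁(2,4,6,1) ∘ W₁₅`, expressed via Siegel units. -/
noncomputable def unitV (τ : ℂ) : ℂ :=
  -(Complex.exp (2 * (π : ℂ) * Complex.I * τ) ^ (-2 : ℤ) *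
    (siegelProd (Complex.exp (2 * (π : ℂ) * Complex.I * τ)) 4 *
      siegelProd (Complex.exp (2 * (π : ℂ) * Complex.I * τ)) 7) /
    (siegelProd (Complex.exp (2 * (π : ℂ) * Complex.I * τ)) 1 *
      siegelProd (Complex.exp (2 * (π : ℂ) * Complex.I * τ)) 2))

open Finset Filter Topology

/-- The finite `Q`-Pochhammer symbol `(Q; Q)_n = ∏_{k=1}^{n} (1 - Qᵏ)`. -/
def qFactorial {K : Type*} [Field K] (Q : K) (n : ℕ) : K :=
  ∏ k ∈ range n, (1 - Q ^ (k + 1))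

section Field

variable {K : Type*} [Field K]

lemma qFactorial_zero (Q : K) : qFactorial Q 0 = 1 := by
  simp [qFactorial]

lemma qFactorial_succ (Q : K) (n : ℕ) :
    qFactorial Q (n + 1) = qFactorial Q n * (1 - Q ^ (n + 1)) :=
  prod_range_succ _ _

/-- The `Q`-binomial theorem. -/
lemma prod_one_add_mul_pow_div_qFactorial {Q : K} (hQ : ∀ n, Q ^ (n + 1) ≠ 1) (y : K) (M : ℕ) :
    (∏ k ∈ range M, (1 + y * Q ^ k)) / qFactorial Q M =
      ∑ p ∈ antidiagonal M,
        Q ^ (p.1.choose 2) * y ^ p.1 / qFactorial Q p.1 * (qFactorial Q p.2)⁻¹ := by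
  have hne (n : ℕ) : 1 - Q ^ (n + 1) ≠ 0 := sub_ne_zero.mpr (hQ n).symm
  induction M with
  | zero => simp [qFactorial_zero]
  | succ M ih =>
    set e : ℕ → K := fun i ↦ Q ^ (i.choose 2) * y ^ i / qFactorial Q i with he
    set f : ℕ → K := fun j ↦ (qFactorial Q j)⁻¹ with hf
    have he_succ (i : ℕ) : (1 - Q ^ (i + 1)) * e (i + 1) = y * Q ^ i * e i := by
      have : (i + 1).choose 2 = i + i.choose 2 := by
        rw [Nat.choose_succ_succ' i 1, Nat.choose_one_right]
      simp only [he, qFactorial_succ, this, pow_add, pow_succ]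
      have := hne i
      rw [pow_succ] at this
      field_simp
    have hf_succ (j : ℕ) : (1 - Q ^ (j + 1)) * f (j + 1) = f j := by
      simp only [hf, qFactorial_succ, mul_inv]
      have := hne j
      field_simp
    have hsplit : (1 - Q ^ (M + 1)) * ∑ p ∈ antidiagonal (M + 1), e p.1 * f p.2 =
        ∑ p ∈ antidiagonal (M + 1), (e p.1 * ((1 - Q ^ p.2) * f p.2)) +
          ∑ p ∈ antidiagonal (M + 1), ((1 - Q ^ p.1) * e p.1 * (Q ^ p.2 * f p.2)) := by
      rw [mul_sum, ← sum_add_distrib]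
      refine sum_congr rfl fun p hp ↦ ?_
      rw [← mem_antidiagonal.mp hp, pow_add]
      ring
    have hmain : (1 - Q ^ (M + 1)) * ∑ p ∈ antidiagonal (M + 1), e p.1 * f p.2 =
        (1 + y * Q ^ M) * ∑ p ∈ antidiagonal M, e p.1 * f p.2 := by
      rw [hsplit, Nat.sum_antidiagonal_succ', Nat.sum_antidiagonal_succ, add_mul, one_mul, mul_sum]
      simp only [hf_succ, he_succ, pow_zero, sub_self, zero_mul, mul_zero, zero_add]
      refine congrArg _ (sum_congr rfl fun p hp ↦ ?_)
      rw [← mem_antidiagonal.mp hp, pow_add]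
      ring
    rw [prod_range_succ, qFactorial_succ, mul_div_mul_comm, ih, ← mul_div_assoc,
      div_eq_iff (hne M), mul_comm, ← hmain, mul_comm]

end Field

open Complex in
/-- The first Jacobi theta function up to an exponential factor: it vanishes on `ℤ + τℤ`. -/
noncomputable def oddTheta (τ z : ℂ) : ℂ :=
  jacobiTheta₂ (z + (1 - τ) / 2) τ

/-- The map `(k, l) ↦ (k + l + ε, k - l)`. For `ε = 0` its range consists of the pairs of integers
of equal parity, for `ε = 1` of the pairs of opposite parity. -/
def sumDiff (ε : ℤ) (p : ℤ × ℤ) : ℤ × ℤ :=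
  (p.1 + p.2 + ε, p.1 - p.2)

lemma sumDiff_injective (ε : ℤ) : (sumDiff ε).Injective := by
  rintro ⟨a, b⟩ ⟨c, d⟩ h
  simp only [sumDiff, Prod.mk.injEq] at h ⊢
  omega

lemma isCompl_range_sumDiff : IsCompl (Set.range (sumDiff 0)) (Set.range (sumDiff 1)) := by
  rw [isCompl_iff, Set.disjoint_left, codisjoint_iff, Set.top_eq_univ, Set.eq_univ_iff_forall]
  refine ⟨?_, fun ⟨m, n⟩ ↦ ?_⟩
  · rintro _ ⟨⟨a, b⟩, rfl⟩ ⟨⟨c, d⟩, h⟩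
    simp only [sumDiff, Prod.mk.injEq] at h
    omega
  · rcases Int.emod_two_eq_zero_or_one (m - n) with h | h
    · exact .inl ⟨((m + n) / 2, (m - n) / 2), by simp only [sumDiff, Prod.mk.injEq]; omega⟩
    · exact .inr ⟨((m + n) / 2, (m - n) / 2), by simp only [sumDiff, Prod.mk.injEq]; omega⟩

lemma hasSum_mul_of_complex {ι κ : Type*} {f : ι → ℂ} {g : κ → ℂ} {a b : ℂ} (hf : HasSum f a)
    (hg : HasSum g b) : HasSum (fun p : ι × κ ↦ f p.1 * g p.2) (a * b) :=
  hf.mul hg (summable_mul_of_summable_norm hf.summable.norm hg.summable.norm)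

lemma hasSum_jacobiTheta₂_term_mul {τ : ℂ} (hτ : 0 < τ.im) (a b : ℂ) :
    HasSum (fun p : ℤ × ℤ ↦ jacobiTheta₂_term p.1 a τ * jacobiTheta₂_term p.2 b τ)
      (jacobiTheta₂ a τ * jacobiTheta₂ b τ) :=
  hasSum_mul_of_complex (f := fun n ↦ jacobiTheta₂_term n a τ)
    (g := fun n ↦ jacobiTheta₂_term n b τ) (hasSum_jacobiTheta₂_term a hτ)
    (hasSum_jacobiTheta₂_term b hτ)

lemma HasSum.of_sumDiff {f : ℤ × ℤ → ℂ} {a b : ℂ} (h₀ : HasSum (fun p ↦ f (sumDiff 0 p)) a)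
    (h₁ : HasSum (fun p ↦ f (sumDiff 1 p)) b) : HasSum f (a + b) :=
  .add_isCompl isCompl_range_sumDiff ((sumDiff_injective 0).hasSum_range_iff.mpr h₀)
    ((sumDiff_injective 1).hasSum_range_iff.mpr h₁)

open Complex in
lemma jacobiTheta₂_add_mul_jacobiTheta₂_sub {τ : ℂ} (hτ : 0 < τ.im) (z w : ℂ) :
    jacobiTheta₂ (z + w) τ * jacobiTheta₂ (z - w) τ =
      jacobiTheta₂ (2 * z) (2 * τ) * jacobiTheta₂ (2 * w) (2 * τ) +
        cexp (2 * π * I * z + π * I * τ / 2) * jacobiTheta₂ (2 * z + τ) (2 * τ) *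
          (cexp (2 * π * I * w + π * I * τ / 2) * jacobiTheta₂ (2 * w + τ) (2 * τ)) := by
  have hτ2 : 0 < (2 * τ).im := by simpa using hτ
  have h₀ (p : ℤ × ℤ) : jacobiTheta₂_term (sumDiff 0 p).1 (z + w) τ *
      jacobiTheta₂_term (sumDiff 0 p).2 (z - w) τ =
        jacobiTheta₂_term p.1 (2 * z) (2 * τ) * jacobiTheta₂_term p.2 (2 * w) (2 * τ) := by
    simp only [sumDiff, jacobiTheta₂_term, ← Complex.exp_add]
    push_cast
    ring_nf
  have h₁ (p : ℤ × ℤ) : jacobiTheta₂_term (sumDiff 1 p).1 (z + w) τ *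
      jacobiTheta₂_term (sumDiff 1 p).2 (z - w) τ =
        cexp (2 * π * I * z + π * I * τ / 2) * cexp (2 * π * I * w + π * I * τ / 2) *
          (jacobiTheta₂_term p.1 (2 * z + τ) (2 * τ) *
            jacobiTheta₂_term p.2 (2 * w + τ) (2 * τ)) := by
    simp only [sumDiff, jacobiTheta₂_term, ← Complex.exp_add]
    push_cast
    ring_nf
  rw [mul_mul_mul_comm]
  refine (hasSum_jacobiTheta₂_term_mul hτ (z + w) (z - w)).unique (HasSum.of_sumDiff ?_ ?_)
  · simp only [h₀]
    exact hasSum_jacobiTheta₂_term_mul hτ2 (2 * z) (2 * w)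
  · simp only [h₁]
    exact (hasSum_jacobiTheta₂_term_mul hτ2 (2 * z + τ) (2 * w + τ)).mul_left _

open Complex in
lemma oddTheta_add_mul_oddTheta_sub {τ : ℂ} (hτ : 0 < τ.im) (z w : ℂ) :
    oddTheta τ (z + w) * oddTheta τ (z - w) =
      cexp (2 * π * I * z - π * I * τ / 2) *
        (cexp (2 * π * I * z + π * I * τ / 2) * jacobiTheta₂ (2 * z + τ) (2 * τ) *
            jacobiTheta₂ (2 * w) (2 * τ) -
          jacobiTheta₂ (2 * z) (2 * τ) *
            (cexp (2 * π * I * w + π * I * τ / 2) * jacobiTheta₂ (2 * w + τ) (2 * τ))) := by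
  have hsub : oddTheta τ (z + w) * oddTheta τ (z - w) =
      jacobiTheta₂ (z + (1 - τ) / 2 + w) τ * jacobiTheta₂ (z + (1 - τ) / 2 - w) τ := by
    simp only [oddTheta]
    ring_nf
  have h₁ : jacobiTheta₂ (2 * (z + (1 - τ) / 2)) (2 * τ) =
      cexp (4 * π * I * z) * jacobiTheta₂ (2 * z + τ) (2 * τ) := by
    have h := jacobiTheta₂_add_left' (2 * z - τ) (2 * τ)
    rw [show 2 * z - τ + 2 * τ = 2 * z + τ by ring] at h
    rw [show 2 * (z + (1 - τ) / 2) = 2 * z - τ + 1 by ring, jacobiTheta₂_add_left, h, ← mul_assoc,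
      ← Complex.exp_add]
    ring_nf
    simp
  have h₂ : jacobiTheta₂ (2 * (z + (1 - τ) / 2) + τ) (2 * τ) = jacobiTheta₂ (2 * z) (2 * τ) := by
    rw [← jacobiTheta₂_add_left (2 * z)]
    ring_nf
  have h₃ : cexp (2 * π * I * (z + (1 - τ) / 2) + π * I * τ / 2) =
      - cexp (2 * π * I * z - π * I * τ / 2) := by
    rw [show 2 * π * I * (z + (1 - τ) / 2) + π * I * τ / 2 =
      2 * π * I * z - π * I * τ / 2 + π * I by ring, Complex.exp_add, exp_pi_mul_I, mul_neg_one]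
  have h₄ : cexp (4 * π * I * z) =
      cexp (2 * π * I * z - π * I * τ / 2) * cexp (2 * π * I * z + π * I * τ / 2) := by
    rw [← Complex.exp_add]
    ring_nf
  rw [hsub, jacobiTheta₂_add_mul_jacobiTheta₂_sub hτ, h₁, h₂, h₃, h₄]
  ring

open Complex in
/-- The Weierstrass three-term relation. -/
lemma oddTheta_three_term {τ : ℂ} (hτ : 0 < τ.im) (x y z w : ℂ) :
    cexp (2 * π * I * y) *
        (oddTheta τ (x + y) * oddTheta τ (x - y) * (oddTheta τ (z + w) * oddTheta τ (z - w))) =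
      cexp (2 * π * I * z) *
        (oddTheta τ (x + z) * oddTheta τ (x - z) * (oddTheta τ (y + w) * oddTheta τ (y - w)) -
          oddTheta τ (x + w) * oddTheta τ (x - w) *
            (oddTheta τ (y + z) * oddTheta τ (y - z))) := by
  simp only [oddTheta_add_mul_oddTheta_sub hτ, sub_eq_add_neg _ (π * I * τ / 2), Complex.exp_add]
  ring

lemma prod_range_mul_zpow_neg {K : Type*} [Field K] {r : K} (hr : r ≠ 0) (x : K) (N : ℕ) :
    ∏ k ∈ range N, x * r ^ (-(2 * k + 1) : ℤ) = x ^ N * r ^ (-(N ^ 2) : ℤ) := by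
  induction N with
  | zero => simp
  | succ N ih =>
    rw [prod_range_succ, ih, mul_mul_mul_comm, ← zpow_add₀ hr, ← pow_succ]
    push_cast
    ring_nf

lemma prod_one_add_mul_zpow {K : Type*} [Field K] {r x : K} (hr : r ≠ 0) (hx : x ≠ 0) (N : ℕ) :
    ∏ k ∈ range (2 * N), (1 + x * r ^ (1 - 2 * N : ℤ) * (r ^ 2) ^ k) =
      x ^ N * r ^ (-(N ^ 2) : ℤ) *
        ∏ k ∈ range N, (1 + x * r ^ (2 * k + 1)) * (1 + x⁻¹ * r ^ (2 * k + 1)) := by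
  have hfactor (k : ℕ) : 1 + x * r ^ (-(2 * k + 1) : ℤ) =
      x * r ^ (-(2 * k + 1) : ℤ) * (1 + x⁻¹ * r ^ (2 * k + 1)) := by
    rw [zpow_neg]
    norm_cast
    field_simp
    ring
  rw [two_mul, prod_range_add,
    ← prod_range_reflect (fun k ↦ 1 + x * r ^ (1 - 2 * N : ℤ) * (r ^ 2) ^ k) N,
    ← prod_range_mul_zpow_neg hr x N, ← prod_mul_distrib, ← prod_mul_distrib]
  refine prod_congr rfl fun k hk ↦ ?_
  rw [mul_comm (1 + x * r ^ (2 * k + 1)), ← mul_assoc, ← hfactor]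
  refine congrArg₂ _ ?_ ?_
  · rw [mul_assoc, ← pow_mul, ← zpow_natCast r (2 * _), ← zpow_add₀ hr]
    have := mem_range.mp hk
    congr 3
    omega
  · rw [mul_assoc, ← pow_mul, ← zpow_natCast r (2 * _), ← zpow_natCast r, ← zpow_add₀ hr]
    congr 3
    push_cast
    ring

/-- A finite form of the Jacobi triple product identity. -/
lemma prod_one_add_mul_one_add_inv {K : Type*} [Field K] {r x : K} (hr : r ≠ 0) (hx : x ≠ 0)
    (hQ : ∀ n, (r ^ 2) ^ (n + 1) ≠ 1) (N : ℕ) :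
    ∏ k ∈ range N, (1 + x * r ^ (2 * k + 1)) * (1 + x⁻¹ * r ^ (2 * k + 1)) =
      ∑ p ∈ antidiagonal (2 * N), r ^ ((p.1 - N) ^ 2 : ℤ) * x ^ (p.1 - N : ℤ) *
        (qFactorial (r ^ 2) (2 * N) * (qFactorial (r ^ 2) p.1)⁻¹ * (qFactorial (r ^ 2) p.2)⁻¹) := by
  have hne : qFactorial (r ^ 2) (2 * N) ≠ 0 :=
    prod_ne_zero_iff.mpr fun n _ ↦ sub_ne_zero.mpr (hQ n).symm
  have h := prod_one_add_mul_pow_div_qFactorial hQ (x * r ^ (1 - 2 * N : ℤ)) (2 * N)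
  rw [prod_one_add_mul_zpow hr hx, div_eq_iff hne] at h
  refine mul_left_cancel₀ (mul_ne_zero (pow_ne_zero N hx) (zpow_ne_zero (-(N ^ 2) : ℤ) hr)) ?_
  rw [h, sum_mul, mul_sum]
  refine sum_congr rfl fun p _ ↦ ?_
  have hchoose : (2 * (p.1.choose 2 : ℤ)) = p.1 * (p.1 - 1) := by
    qify
    rw [Nat.cast_choose_two]
    ring
  have hterm : (r ^ 2) ^ p.1.choose 2 * (x * r ^ (1 - 2 * N : ℤ)) ^ p.1 =
      x ^ N * r ^ (-(N ^ 2) : ℤ) * (r ^ ((p.1 - N) ^ 2 : ℤ) * x ^ (p.1 - N : ℤ)) := by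
    have hexp : (2 * (p.1.choose 2 : ℤ)) + (1 - 2 * N) * p.1 = -(N ^ 2) + (p.1 - N) ^ 2 := by
      rw [hchoose]
      ring
    calc (r ^ 2) ^ p.1.choose 2 * (x * r ^ (1 - 2 * N : ℤ)) ^ p.1
        = x ^ p.1 * r ^ (2 * (p.1.choose 2 : ℤ) + (1 - 2 * N) * p.1) := by
          rw [zpow_add₀ hr, zpow_mul, zpow_mul, zpow_natCast, zpow_natCast, zpow_ofNat, mul_pow]
          ring
      _ = x ^ N * r ^ (-(N ^ 2) : ℤ) * (r ^ ((p.1 - N) ^ 2 : ℤ) * x ^ (p.1 - N : ℤ)) := by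
          rw [hexp, zpow_add₀ hr, zpow_sub₀ hx, zpow_natCast, zpow_natCast]
          field_simp
  rw [hterm]
  ring

lemma norm_pow_lt_one {q : ℂ} (hq : ‖q‖ < 1) {n : ℕ} (hn : n ≠ 0) : ‖q ^ n‖ < 1 := by
  simpa using pow_lt_one₀ (norm_nonneg q) hq hn

lemma multipliable_one_sub_mul_pow_of_norm_lt_one {Q : ℂ} (hQ : ‖Q‖ < 1) (c : ℂ) :
    Multipliable fun k : ℕ ↦ 1 - c * Q ^ k := by
  simp only [sub_eq_add_neg]
  refine multipliable_one_add_of_summable ?_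
  simpa using (summable_geometric_of_lt_one (norm_nonneg _) hQ).mul_left ‖c‖

lemma tprod_one_sub_mul_pow_ne_zero {Q c : ℂ} (hQ : ‖Q‖ < 1) (hc : ‖c‖ < 1) :
    ∏' k : ℕ, (1 - c * Q ^ k) ≠ 0 := by
  simp only [sub_eq_add_neg]
  refine tprod_one_add_ne_zero_of_summable (fun k h ↦ ?_) ?_
  · have h₁ : ‖c * Q ^ k‖ < 1 := by
      rw [norm_mul, norm_pow]
      exact mul_lt_one_of_nonneg_of_lt_one_left (norm_nonneg _) hc
        (pow_le_one₀ (norm_nonneg _) hQ.le)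
    rw [← sub_eq_add_neg, sub_eq_zero] at h
    simp [← h] at h₁
  · simpa using (summable_geometric_of_lt_one (norm_nonneg _) hQ).mul_left ‖c‖

lemma tprod_one_sub_pow_ne_zero {Q : ℂ} (hQ : ‖Q‖ < 1) : ∏' k : ℕ, (1 - Q ^ (k + 1)) ≠ 0 := by
  simpa only [pow_succ'] using tprod_one_sub_mul_pow_ne_zero hQ hQ

lemma norm_exp_two_pi_mul_I_mul_lt_one {τ : ℂ} (hτ : 0 < τ.im) :
    ‖Complex.exp (2 * π * Complex.I * τ)‖ < 1 := by
  rw [Complex.norm_exp, Real.exp_lt_one_iff]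
  simp [hτ, Real.pi_pos]

lemma siegelProd_eq {q : ℂ} (hq : ‖q‖ < 1) {a : ℕ} (ha : 0 < a) (ha' : a < 15) :
    siegelProd q a =
      (∏' k : ℕ, (1 - q ^ a * (q ^ 15) ^ k)) * ∏' k : ℕ, (1 - q ^ (15 - a) * (q ^ 15) ^ k) := by
  have hQ : ‖q ^ 15‖ < 1 := norm_pow_lt_one hq (by norm_num)
  have hres {b : ℕ} (hb : 0 < b) (hb' : b < 15) :
      HasProd (fun n : ℕ ↦ if (n + 1) % 15 = b then 1 - q ^ (n + 1) else 1)
        (∏' k : ℕ, (1 - q ^ b * (q ^ 15) ^ k)) := by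
    have hinj : (fun k : ℕ ↦ 15 * k + (b - 1)).Injective := fun k l h ↦ by
      simp only at h; omega
    rw [← hinj.hasProd_iff]
    · convert (multipliable_one_sub_mul_pow_of_norm_lt_one hQ (q ^ b)).hasProd using 2 with k
      have h₁ : 15 * k + (b - 1) + 1 = b + 15 * k := by omega
      have h₂ : (b + 15 * k) % 15 = b := by omega
      simp only [Function.comp_apply, h₁, h₂, if_true]
      rw [pow_add, pow_mul]
    · intro n hn
      refine if_neg fun h ↦ hn ⟨n / 15, ?_⟩
      simp only
      omega
  rw [← ((hres ha ha').mul (hres (b := 15 - a) (by omega) (by omega))).tprod_eq, siegelProd]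
  refine tprod_congr fun n ↦ ?_
  split_ifs <;> first | omega | simp

lemma siegelProd_fifteen_sub (q : ℂ) {a : ℕ} (ha : a ≤ 15) :
    siegelProd q (15 - a) = siegelProd q a := by
  simp only [siegelProd, Nat.sub_sub_self ha, or_comm]

lemma siegelProd_ne_zero {q : ℂ} (hq : ‖q‖ < 1) {a : ℕ} (ha : 0 < a) (ha' : a < 15) :
    siegelProd q a ≠ 0 := by
  have hQ : ‖q ^ 15‖ < 1 := norm_pow_lt_one hq (by norm_num)
  rw [siegelProd_eq hq ha ha']
  exact mul_ne_zero (tprod_one_sub_mul_pow_ne_zero hQ (norm_pow_lt_one hq ha.ne'))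
    (tprod_one_sub_mul_pow_ne_zero hQ (norm_pow_lt_one hq (by omega)))

open Complex in
/-- The Jacobi triple product identity. -/
theorem tendsto_prod_jacobiTheta₂ {τ : ℂ} (hτ : 0 < τ.im) (z : ℂ) :
    Tendsto (fun N : ℕ ↦ ∏ k ∈ range N,
      (1 + cexp (2 * π * I * z) * cexp (π * I * τ) ^ (2 * k + 1)) *
        (1 + (cexp (2 * π * I * z))⁻¹ * cexp (π * I * τ) ^ (2 * k + 1))) atTop
      (𝓝 (jacobiTheta₂ z τ *
        (∏' k : ℕ, (1 - (cexp (π * I * τ) ^ 2) ^ (k + 1)))⁻¹)) := by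
  set r := cexp (π * I * τ) with hr
  set x := cexp (2 * π * I * z)
  have hQ : ‖r ^ 2‖ < 1 := by
    convert norm_exp_two_pi_mul_I_mul_lt_one hτ using 2
    rw [hr, ← Complex.exp_nat_mul]
    push_cast
    ring_nf
  have hQ1 (n : ℕ) : (r ^ 2) ^ (n + 1) ≠ 1 := fun h ↦ by
    simpa [h] using norm_pow_lt_one hQ n.succ_ne_zero
  set c := ∏' k : ℕ, (1 - (r ^ 2) ^ (k + 1))
  have hc0 : c ≠ 0 := tprod_one_sub_pow_ne_zero hQ
  have hA : Tendsto (qFactorial (r ^ 2)) atTop (𝓝 c) :=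
    (ModularForm.multipliable_one_sub_pow hQ).tendsto_prod_tprod_nat
  have hAinv : Tendsto (fun n ↦ (qFactorial (r ^ 2) n)⁻¹) atTop (𝓝 c⁻¹) := hA.inv₀ hc0
  obtain ⟨B, hB⟩ := hA.norm.bddAbove_range
  obtain ⟨B', hB'⟩ := hAinv.norm.bddAbove_range
  replace hB (n : ℕ) : ‖qFactorial (r ^ 2) n‖ ≤ B := hB ⟨n, rfl⟩
  replace hB' (n : ℕ) : ‖(qFactorial (r ^ 2) n)⁻¹‖ ≤ B' := hB' ⟨n, rfl⟩
  have hB0 : 0 ≤ B := (norm_nonneg _).trans (hB 0)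
  have hB0' : 0 ≤ B' := (norm_nonneg _).trans (hB' 0)
  let F (N : ℕ) (n : ℤ) : ℂ := if -N ≤ n ∧ n ≤ N then
    jacobiTheta₂_term n z τ * (qFactorial (r ^ 2) (2 * N) * (qFactorial (r ^ 2) (N + n).toNat)⁻¹ *
      (qFactorial (r ^ 2) (N - n).toNat)⁻¹) else 0
  have hF (N : ℕ) : ∏ k ∈ range N, (1 + x * r ^ (2 * k + 1)) * (1 + x⁻¹ * r ^ (2 * k + 1)) =
      ∑' n, F N n := by
    rw [prod_one_add_mul_one_add_inv (Complex.exp_ne_zero _) (Complex.exp_ne_zero _) hQ1 N,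
      tsum_eq_sum (s := (antidiagonal (2 * N)).image fun p ↦ (p.1 - N : ℤ)), sum_image]
    · refine sum_congr rfl fun p hp ↦ ?_
      have hp' := HasAntidiagonal.mem_antidiagonal.mp hp
      have h₁ : (N + (p.1 - N : ℤ)).toNat = p.1 := by omega
      have h₂ : (N - (p.1 - N : ℤ)).toNat = p.2 := by omega
      simp only [F]
      rw [if_pos (by omega), h₁, h₂]
      congr 1
      rw [jacobiTheta₂_term, ← Complex.exp_int_mul, ← Complex.exp_int_mul,
        ← Complex.exp_add]
      push_cast
      ring_nf
    · intro p hp p' hp' h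
      have := HasAntidiagonal.mem_antidiagonal.mp hp
      have := HasAntidiagonal.mem_antidiagonal.mp hp'
      ext <;> (simp only at h; omega)
    · intro n hn
      refine if_neg fun h ↦ hn (mem_image.mpr ⟨((N + n).toNat, (N - n).toNat), ?_, ?_⟩)
      · rw [HasAntidiagonal.mem_antidiagonal]
        omega
      · simp only
        omega
  simp only [hF]
  rw [jacobiTheta₂, ← tsum_mul_right]
  refine tendsto_tsum_of_dominated_convergence
    (bound := fun n ↦ ‖jacobiTheta₂_term n z τ‖ * (B * B' * B'))
    (((summable_jacobiTheta₂_term_iff z τ).mpr hτ).norm.mul_right _) (fun n ↦ ?_)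
    (.of_forall fun N n ↦ ?_)
  · have hlim : Tendsto (fun N : ℕ ↦ jacobiTheta₂_term n z τ * (qFactorial (r ^ 2) (2 * N) *
        (qFactorial (r ^ 2) (N + n).toNat)⁻¹ * (qFactorial (r ^ 2) (N - n).toNat)⁻¹)) atTop
        (𝓝 (jacobiTheta₂_term n z τ * (c * c⁻¹ * c⁻¹))) := by
      refine (((hA.comp ?_).mul (hAinv.comp ?_)).mul (hAinv.comp ?_)).const_mul _
      · exact tendsto_atTop_mono (fun N ↦ by simp only [id]; omega) tendsto_id
      · exact tendsto_atTop.mpr fun b ↦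
          (eventually_ge_atTop (b + n.natAbs)).mono fun N hN ↦ by omega
      · exact tendsto_atTop.mpr fun b ↦
          (eventually_ge_atTop (b + n.natAbs)).mono fun N hN ↦ by omega
    rw [mul_inv_cancel₀ hc0, one_mul] at hlim
    refine hlim.congr' ((eventually_ge_atTop n.natAbs).mono fun N hN ↦ ?_)
    exact (if_pos (by omega)).symm
  · simp only [F]
    split_ifs
    · rw [norm_mul, norm_mul, norm_mul]
      gcongr
      exacts [hB _, hB' _, hB' _]
    · rw [norm_zero]
      positivity

open Complex in
lemma oddTheta_eq_siegelProd_mul {τ : ℂ} (hτ : 0 < τ.im) {a : ℕ} (ha : 0 < a) (ha' : a < 15) :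
    oddTheta (15 * τ) (a * τ) = siegelProd (cexp (2 * π * I * τ)) a *
      ∏' k : ℕ, (1 - (cexp (2 * π * I * τ) ^ 15) ^ (k + 1)) := by
  set q := cexp (2 * π * I * τ) with hq
  have hq1 : ‖q‖ < 1 := norm_exp_two_pi_mul_I_mul_lt_one hτ
  have hQ : ‖q ^ 15‖ < 1 := norm_pow_lt_one hq1 (by norm_num)
  have hc0 : ∏' k : ℕ, (1 - (q ^ 15) ^ (k + 1)) ≠ 0 := tprod_one_sub_pow_ne_zero hQ
  have hr : cexp (π * I * (15 * τ)) ^ 2 = q ^ 15 := by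
    rw [hq, ← Complex.exp_nat_mul, ← Complex.exp_nat_mul]
    push_cast
    ring_nf
  have hx : cexp (2 * π * I * (a * τ + (1 - 15 * τ) / 2)) * cexp (π * I * (15 * τ)) = - q ^ a := by
    rw [hq, ← Complex.exp_nat_mul, ← Complex.exp_add, ← mul_neg_one, ← exp_pi_mul_I,
      ← Complex.exp_add]
    ring_nf
  have hx' : (cexp (2 * π * I * (a * τ + (1 - 15 * τ) / 2)))⁻¹ * cexp (π * I * (15 * τ)) =
      - q ^ (15 - a) := by
    have hmul : q ^ a * q ^ (15 - a) = q ^ 15 := by rw [← pow_add, Nat.add_sub_cancel' ha'.le]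
    refine mul_left_cancel₀ (neg_ne_zero.mpr (pow_ne_zero a (Complex.exp_ne_zero _) : q ^ a ≠ 0)) ?_
    rw [neg_mul_neg, hmul, ← hx, ← hr]
    field_simp
  have hlim := tendsto_prod_jacobiTheta₂ (τ := 15 * τ) (by simpa using hτ)
    (a * τ + (1 - 15 * τ) / 2)
  have hpow (x : ℂ) (k : ℕ) : x * cexp (π * I * (15 * τ)) ^ (2 * k + 1) =
      x * cexp (π * I * (15 * τ)) * (q ^ 15) ^ k := by
    rw [pow_succ, pow_mul, hr]
    ring
  simp only [hpow, hx, hx', hr, neg_mul, ← sub_eq_add_neg, prod_mul_distrib] at hlim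
  have hlim' := (multipliable_one_sub_mul_pow_of_norm_lt_one hQ (q ^ a)).tendsto_prod_tprod_nat.mul
    (multipliable_one_sub_mul_pow_of_norm_lt_one hQ (q ^ (15 - a))).tendsto_prod_tprod_nat
  rw [siegelProd_eq hq1 ha ha', tendsto_nhds_unique hlim' hlim, oddTheta,
    inv_mul_cancel_right₀ hc0]

open Complex in
/-- The three-term relation for the products `siegelProd q a`. -/
lemma siegelProd_three_term {τ : ℂ} (hτ : 0 < τ.im) {x y z w : ℕ} (hxy : y < x) (hyz : z < y)
    (hzw : w < z) (hx : x + y < 15) :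
    cexp (2 * π * I * τ) ^ y *
        (siegelProd (cexp (2 * π * I * τ)) (x + y) * siegelProd (cexp (2 * π * I * τ)) (x - y) *
          (siegelProd (cexp (2 * π * I * τ)) (z + w) *
            siegelProd (cexp (2 * π * I * τ)) (z - w))) =
      cexp (2 * π * I * τ) ^ z *
        (siegelProd (cexp (2 * π * I * τ)) (x + z) * siegelProd (cexp (2 * π * I * τ)) (x - z) *
            (siegelProd (cexp (2 * π * I * τ)) (y + w) *
              siegelProd (cexp (2 * π * I * τ)) (y - w)) -
          siegelProd (cexp (2 * π * I * τ)) (x + w) * siegelProd (cexp (2 * π * I * τ)) (x - w) *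
            (siegelProd (cexp (2 * π * I * τ)) (y + z) *
              siegelProd (cexp (2 * π * I * τ)) (y - z))) := by
  have hadd {m n : ℕ} (h : n < m) (h' : m + n < 15) :
      oddTheta (15 * τ) (m * τ + n * τ) = siegelProd (cexp (2 * π * I * τ)) (m + n) *
        ∏' k : ℕ, (1 - (cexp (2 * π * I * τ) ^ 15) ^ (k + 1)) := by
    rw [← oddTheta_eq_siegelProd_mul hτ (by omega) h', Nat.cast_add, add_mul]
  have hsub {m n : ℕ} (h : n < m) (h' : m + n < 15) :
      oddTheta (15 * τ) (m * τ - n * τ) = siegelProd (cexp (2 * π * I * τ)) (m - n) *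
        ∏' k : ℕ, (1 - (cexp (2 * π * I * τ) ^ 15) ^ (k + 1)) := by
    rw [← oddTheta_eq_siegelProd_mul hτ (by omega) (by omega), Nat.cast_sub h.le, sub_mul]
  have hexp (n : ℕ) : cexp (2 * π * I * (n * τ)) = cexp (2 * π * I * τ) ^ n := by
    rw [← Complex.exp_nat_mul]
    ring_nf
  have hc0 : ∏' k : ℕ, (1 - (cexp (2 * π * I * τ) ^ 15) ^ (k + 1)) ≠ 0 :=
    tprod_one_sub_pow_ne_zero (norm_pow_lt_one (norm_exp_two_pi_mul_I_mul_lt_one hτ) (by norm_num))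
  have h := oddTheta_three_term (τ := 15 * τ) (by simpa using hτ) (x * τ) (y * τ) (z * τ) (w * τ)
  rw [hadd hxy hx, hsub hxy hx, hadd hzw (by omega), hsub hzw (by omega),
    hadd (hyz.trans hxy) (by omega), hsub (hyz.trans hxy) (by omega),
    hadd (hzw.trans hyz) (by omega), hsub (hzw.trans hyz) (by omega),
    hadd (hzw.trans (hyz.trans hxy)) (by omega), hsub (hzw.trans (hyz.trans hxy)) (by omega),
    hadd hyz (by omega), hsub hyz (by omega), hexp, hexp] at h
  refine mul_right_cancel₀ (pow_ne_zero 4 hc0) ?_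
  linear_combination h

/-- For every `τ` in the upper half-plane, `(1+u(τ))²(1+v(τ))² = u(τ)·v(τ)`. -/
theorem units_satisfy_curve_equation (τ : ℂ) (hτ : 0 < τ.im) :
    (1 + unitU τ) ^ 2 * (1 + unitV τ) ^ 2 = unitU τ * unitV τ := by
  have hne {a : ℕ} (ha : 0 < a) (ha' : a < 15) :
      siegelProd (Complex.exp (2 * (π : ℂ) * Complex.I * τ)) a ≠ 0 :=
    siegelProd_ne_zero (norm_exp_two_pi_mul_I_mul_lt_one hτ) ha ha'
  have hu := siegelProd_three_term hτ (x := 7) (y := 4) (z := 3) (w := 2)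
    (by norm_num) (by norm_num) (by norm_num) (by norm_num)
  have hv := siegelProd_three_term hτ (x := 6) (y := 4) (z := 2) (w := 1)
    (by norm_num) (by norm_num) (by norm_num) (by norm_num)
  have hq := Complex.exp_ne_zero (2 * (π : ℂ) * Complex.I * τ)
  simp only [unitU, unitV]
  generalize Complex.exp (2 * (π : ℂ) * Complex.I * τ) = q at *
  have h8 := siegelProd_fifteen_sub q (a := 7) (by norm_num)
  have h9 := siegelProd_fifteen_sub q (a := 6) (by norm_num)
  have h10 := siegelProd_fifteen_sub q (a := 5) (by norm_num)
  have h11 := siegelProd_fifteen_sub q (a := 4) (by norm_num)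
  norm_num at hu hv h8 h9 h10 h11
  rw [h9, h10, h11] at hu
  rw [h8, h10] at hv
  have h1 := hne (a := 1) (by norm_num) (by norm_num)
  have h2 := hne (a := 2) (by norm_num) (by norm_num)
  have h3 := hne (a := 3) (by norm_num) (by norm_num)
  have h4 := hne (a := 4) (by norm_num) (by norm_num)
  have h5 := hne (a := 5) (by norm_num) (by norm_num)
  have h6 := hne (a := 6) (by norm_num) (by norm_num)
  have h7 := hne (a := 7) (by norm_num) (by norm_num)
  clear hne h8 h9 h10 h11
  generalize siegelProd q 1 = e₁ at *
  generalize siegelProd q 2 = e₂ at *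
  generalize siegelProd q 3 = e₃ at *
  generalize siegelProd q 4 = e₄ at *
  generalize siegelProd q 5 = e₅ at *
  generalize siegelProd q 6 = e₆ at *
  generalize siegelProd q 7 = e₇ at *
  have hu' : (e₂ * e₄ - e₁ * e₇) * e₆ = q * e₁ * e₃ * e₄ := by
    refine mul_left_cancel₀ (mul_ne_zero (pow_ne_zero 3 hq) h5) ?_
    linear_combination -hu
  have hv' : (e₄ * e₇ - q ^ 2 * e₁ * e₂) * e₃ = e₂ * e₆ * e₇ := by
    refine mul_left_cancel₀ (mul_ne_zero (pow_ne_zero 2 hq) h5) ?_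
    linear_combination -hv
  have hu'' : 1 + -(e₂ * e₄ / (e₁ * e₇)) = -(q * e₃ * e₄ / (e₆ * e₇)) := by
    field_simp
    linear_combination -hu'
  have hv'' : 1 + -(q ^ (-2 : ℤ) * (e₄ * e₇) / (e₁ * e₂)) =
      -(e₆ * e₇ / (q ^ 2 * e₁ * e₃)) := by
    rw [zpow_neg, zpow_ofNat]
    field_simp
    linear_combination -hv'
  rw [hu'', hv'', zpow_neg, zpow_ofNat]
  field_simp
end

section
/- For nonzero complex numbers x, y, z, the two equations (1+x)(1+y) + z = 0 and (1+1/x)(1+1/y) + 1/z = 0 hold simultaneously if and only if z = -(1+x)(1+y) and (1+x)²(1+y)² = xy. In particular, the Maillot variety W_P of P = (1+x)(1+y)+z in (ℂ^×)³ is isomorphic (via forgetting z) to the curve C : (1+x)²(1+y)² = xy in (ℂ^×)². -/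
/-- The Maillot variety of `P = (1+x)(1+y)+z` in `(ℂ^×)³`. -/
def maillotVariety : Set (ℂ × ℂ × ℂ) :=
  {p | p.1 ≠ 0 ∧ p.2.1 ≠ 0 ∧ p.2.2 ≠ 0 ∧
    (1 + p.1) * (1 + p.2.1) + p.2.2 = 0 ∧
    (1 + 1 / p.1) * (1 + 1 / p.2.1) + 1 / p.2.2 = 0}

/-- The curve `C : (1+x)²(1+y)² = xy` in `(ℂ^×)²`. -/
def curveC : Set (ℂ × ℂ) :=
  {p | p.1 ≠ 0 ∧ p.2 ≠ 0 ∧ (1 + p.1) ^ 2 * (1 + p.2) ^ 2 = p.1 * p.2}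

/-- For nonzero `x, y, z`, the two equations defining the Maillot variety are equivalent to
`z = -(1+x)(1+y)` together with the equation of the curve. -/
theorem maillot_equations_iff {x y z : ℂ} (hx : x ≠ 0) (hy : y ≠ 0) (hz : z ≠ 0) :
    ((1 + x) * (1 + y) + z = 0 ∧ (1 + 1/x) * (1 + 1/y) + 1/z = 0) ↔
      (z = -((1 + x) * (1 + y)) ∧ (1 + x) ^ 2 * (1 + y) ^ 2 = x * y) := by
  have key : ((1 + 1/x) * (1 + 1/y) + 1/z) * (x * y * z) = (1 + x) * (1 + y) * z + x * y := by
    field_simp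
    ring
  have hxyz : x * y * z ≠ 0 := mul_ne_zero (mul_ne_zero hx hy) hz
  constructor
  · rintro ⟨h₁, h₂⟩
    rw [h₂, zero_mul] at key
    exact ⟨by linear_combination h₁, by linear_combination key + (1 + x) * (1 + y) * h₁⟩
  · rintro ⟨h₁, h₂⟩
    refine ⟨by linear_combination h₁, (mul_eq_zero_iff_right hxyz).mp ?_⟩
    rw [key]
    linear_combination (1 + x) * (1 + y) * h₁ - h₂

/-- For nonzero `x, y, z`, the equations `(1+x)(1+y)+z = 0` and
`(1+1/x)(1+1/y)+1/z = 0` hold simultaneously iff `z = -(1+x)(1+y)` and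
`(1+x)²(1+y)² = xy`; in particular the Maillot variety of `(1+x)(1+y)+z` is
isomorphic, via forgetting `z`, to the curve `C : (1+x)²(1+y)² = xy`. -/
theorem maillot_variety_eq_curve :
    (∀ x y z : ℂ, x ≠ 0 → y ≠ 0 → z ≠ 0 →
      (((1 + x) * (1 + y) + z = 0 ∧ (1 + 1/x) * (1 + 1/y) + 1/z = 0) ↔
        (z = -((1 + x) * (1 + y)) ∧ (1 + x) ^ 2 * (1 + y) ^ 2 = x * y)))
    ∧ Set.BijOn (fun p : ℂ × ℂ × ℂ => (p.1, p.2.1)) maillotVariety curveC := by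
  refine ⟨fun x y z hx hy hz => maillot_equations_iff hx hy hz, ?_, ?_, ?_⟩
  · rintro ⟨x, y, z⟩ ⟨hx, hy, hz, h⟩
    exact ⟨hx, hy, ((maillot_equations_iff hx hy hz).mp h).2⟩
  · rintro ⟨x, y, z⟩ ⟨-, -, -, h, -⟩ ⟨x', y', z'⟩ ⟨-, -, -, h', -⟩ hxy
    obtain ⟨rfl, rfl⟩ := Prod.mk.inj hxy
    exact congrArg (fun w => (x, y, w)) (add_left_cancel (h.trans h'.symm))
  · rintro ⟨x, y⟩ ⟨hx, hy, h⟩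
    have hz : -((1 + x) * (1 + y)) ≠ 0 := by
      intro h₀
      refine mul_ne_zero hx hy ?_
      linear_combination -(1 + x) * (1 + y) * h₀ - h
    exact ⟨(x, y, -((1 + x) * (1 + y))),
      ⟨hx, hy, hz, (maillot_equations_iff hx hy hz).mpr ⟨rfl, h⟩⟩, rfl⟩
end

section
/- The affine curve C : (1+x)²(1+y)² = xy is smooth in (ℂ^×)²: for every pair (x,y) of nonzero complex numbers satisfying (1+x)²(1+y)² = xy, the two partial derivatives 2(1+x)(1+y)² - y and 2(1+x)²(1+y) - x of F(x,y) = (1+x)²(1+y)² - xy do not vanish simultaneously. -/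
/-- The affine curve `C : (1+x)²(1+y)² = xy` is smooth in `(ℂ^×)²`: the partial
derivatives of `F(x,y) = (1+x)²(1+y)² - xy` never vanish simultaneously on `C`. -/
theorem curveC_smooth (x y : ℂ) (hx : x ≠ 0) (hy : y ≠ 0)
    (h : (1 + x) ^ 2 * (1 + y) ^ 2 = x * y) :
    ¬(2 * (1 + x) * (1 + y) ^ 2 - y = 0 ∧ 2 * (1 + x) ^ 2 * (1 + y) - x = 0) := by
  rintro ⟨h₁, h₂⟩
  have hx1 : x - 1 = 0 := (mul_eq_zero.mp
    (by linear_combination (1 + x) * h₁ - 2 * h : y * (x - 1) = 0)).resolve_left hy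
  have hy1 : y - 1 = 0 := (mul_eq_zero.mp
    (by linear_combination (1 + y) * h₂ - 2 * h : x * (y - 1) = 0)).resolve_left hx
  rw [sub_eq_zero.mp hx1, sub_eq_zero.mp hy1] at h
  norm_num at h
end

section
/- Let Θ = 2·arccos(1/4). For every θ ∈ [0, Θ), set c = cos(θ/2) (so c ∈ (1/4, 1]), ψ = 2·arccos(1/(4c)), x = e^{iθ} and y = e^{-iψ}. Then (x,y) lies on the curve (1+x)²(1+y)² = xy, and the invariant differential ω_E = -dx/(2(x+1)²(y+1) - x) of this curve pulls back along this parametrisation to the real positive 1-form dθ/√(16cos²(θ/2) - 1); precisely, -i·x / (2(x+1)²(y+1) - x) = 1/√(16 c² - 1). -/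
open Real

theorem one_add_exp_mul_I_sq (t : ℝ) :
    1 + Complex.exp (t * Complex.I) ^ 2 = 2 * (Real.cos t : ℂ) * Complex.exp (t * Complex.I) := by
  have h : (Real.cos t : ℂ) ^ 2 + (Real.sin t : ℂ) ^ 2 = 1 := by
    exact_mod_cast Real.cos_sq_add_sin_sq t
  rw [Complex.exp_ofReal_mul_I]
  linear_combination (-1 : ℂ) * h + (Real.sin t : ℂ) ^ 2 * Complex.I_sq

/-- Parametrisation of a quarter `γ` of the boundary of the Deninger chain:
for `θ ∈ [0, 2·arccos(1/4))`, the point `(x,y) = (e^{iθ}, e^{-iψ})` with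
`ψ = 2·arccos(1/(4cos(θ/2)))` lies on the curve `(1+x)²(1+y)² = xy`, and the
invariant differential `ω_E = -dx/(2(x+1)²(y+1) - x)` pulls back to the real
positive 1-form `dθ/√(16cos²(θ/2) - 1)`. -/
theorem pullback_invariant_differential (θ : ℝ)
    (hθ : θ ∈ Set.Ico (0 : ℝ) (2 * Real.arccos (1 / 4)))
    (c : ℝ) (hc : c = Real.cos (θ / 2))
    (ψ : ℝ) (hψ : ψ = 2 * Real.arccos (1 / (4 * c)))
    (x : ℂ) (hx : x = Complex.exp ((θ : ℂ) * Complex.I))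
    (y : ℂ) (hy : y = Complex.exp (-(ψ : ℂ) * Complex.I)) :
    (1 + x) ^ 2 * (1 + y) ^ 2 = x * y ∧
    -Complex.I * x / (2 * (x + 1) ^ 2 * (y + 1) - x) =
      ((1 / Real.sqrt (16 * c ^ 2 - 1) : ℝ) : ℂ) := by
  have hc4 : 1 / 4 < c := by
    have h := Real.cos_lt_cos_of_nonneg_of_le_pi (by linarith [hθ.1] : 0 ≤ θ / 2)
      (Real.arccos_le_pi (1 / 4)) (by linarith [hθ.2])
    rwa [Real.cos_arccos (by norm_num) (by norm_num), ← hc] at h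
  have hc0 : 0 < c := by linarith
  have hd0 : 0 ≤ 1 / (4 * c) := by positivity
  have hd1 : 1 / (4 * c) ≤ 1 := by
    rw [div_le_one (by positivity)]
    linarith
  have hψ2 : ψ / 2 = Real.arccos (1 / (4 * c)) := by rw [hψ]; ring
  have hcosψ : Real.cos (ψ / 2) = 1 / (4 * c) := by
    rw [hψ2, Real.cos_arccos (by linarith) hd1]
  have hsinψ : 4 * c * Real.sin (ψ / 2) = √(16 * c ^ 2 - 1) := by
    have hs : 0 ≤ Real.sin (ψ / 2) := by
      rw [hψ2]
      exact Real.sin_nonneg_of_nonneg_of_le_pi (Real.arccos_nonneg _) (Real.arccos_le_pi _)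
    have hsq : 16 * c ^ 2 - 1 = (4 * c * Real.sin (ψ / 2)) ^ 2 := by
      rw [mul_pow, Real.sin_sq, hcosψ]
      field_simp
      ring
    rw [hsq, Real.sqrt_sq (by positivity)]
  set u : ℂ := Complex.exp ((θ / 2 : ℝ) * Complex.I) with hu
  set v : ℂ := Complex.exp (-(ψ / 2 : ℝ) * Complex.I) with hv
  have hxu : x = u ^ 2 := by
    rw [hx, hu, ← Complex.exp_nat_mul]
    congr 1
    push_cast
    ring
  have hyv : y = v ^ 2 := by
    rw [hy, hv, ← Complex.exp_nat_mul]
    congr 1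
    push_cast
    ring
  have hu0 : u ≠ 0 := Complex.exp_ne_zero _
  have hcC : (c : ℂ) ≠ 0 := by exact_mod_cast hc0.ne'
  have hx1 : 1 + x = 2 * c * u := by
    rw [hxu, one_add_exp_mul_I_sq, ← hc]
  have hv2 : v = 1 / (4 * c) - Real.sin (ψ / 2) * Complex.I := by
    rw [hv, ← Complex.ofReal_neg, Complex.exp_ofReal_mul_I, Real.cos_neg, Real.sin_neg, hcosψ]
    push_cast
    ring
  have hy1 : 2 * c * (1 + y) = v := by
    rw [hyv, hv, ← Complex.ofReal_neg, one_add_exp_mul_I_sq, Real.cos_neg, hcosψ]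
    push_cast
    field_simp
    ring
  have hxy : (1 + x) * (1 + y) = u * v := by
    rw [hx1, ← hy1]
    ring
  refine ⟨by rw [← mul_pow, hxy, hxu, hyv]; ring, ?_⟩
  have hden : 2 * (x + 1) ^ 2 * (y + 1) - x = -Complex.I * √(16 * c ^ 2 - 1) * x := by
    calc 2 * (x + 1) ^ 2 * (y + 1) - x = 2 * (1 + x) * ((1 + x) * (1 + y)) - x := by ring
      _ = (4 * c * v - 1) * u ^ 2 := by rw [hxy, hx1, hxu]; ring
      _ = -Complex.I * √(16 * c ^ 2 - 1) * x := by
        rw [← hsinψ, hxu, hv2]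
        push_cast
        field_simp
        ring
  have hx0 : x ≠ 0 := hxu ▸ pow_ne_zero 2 hu0
  have hIx : -Complex.I * x ≠ 0 := mul_ne_zero (neg_ne_zero.2 Complex.I_ne_zero) hx0
  rw [hden, mul_right_comm, div_mul_cancel_left₀ hIx]
  push_cast
  rw [one_div]
end

section
/- For every τ in the upper half-plane, u′(τ) = 2πi · f(τ) · ( 2(u(τ)+1)²(v(τ)+1) - u(τ) ), where u′ denotes the complex derivative of u with respect to τ. Equivalently, the pullback of the invariant differential ω_E = -dx/(2(x+1)²(y+1)-x) of the curve (1+x)²(1+y)²=xy under τ ↦ (u(τ), v(τ)) equals -2πi f(τ) dτ. -/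
open Real

/-- The eta-product newform `f₁₅(τ) = q ∏_{n≥1}(1-qⁿ)(1-q³ⁿ)(1-q⁵ⁿ)(1-q¹⁵ⁿ)`
of weight 2 and level 15, with `q = e^{2πiτ}`. -/
noncomputable def newform15 (τ : ℂ) : ℂ :=
  Complex.exp (2 * (π : ℂ) * Complex.I * τ) *
    ∏' n : ℕ, ((1 - Complex.exp (2 * (π : ℂ) * Complex.I * τ) ^ (n + 1)) *
      (1 - Complex.exp (2 * (π : ℂ) * Complex.I * τ) ^ (3 * (n + 1))) *
      (1 - Complex.exp (2 * (π : ℂ) * Complex.I * τ) ^ (5 * (n + 1))) *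
      (1 - Complex.exp (2 * (π : ℂ) * Complex.I * τ) ^ (15 * (n + 1))))

open Filter Topology

/-- The `j`-th moment `∑ₙ ω(n) (n + s)ʲ exp (c (n + s)²)` of a Gaussian sum with weights `ω`. -/
noncomputable def gaussMoment (ω : ℤ → ℂ) (j : ℕ) (s c : ℂ) : ℂ :=
  ∑' n : ℤ, ω n * (n + s) ^ j * Complex.exp (c * (n + s) ^ 2)

theorem exists_summable_bound_gaussMoment (j : ℕ) (S R : ℝ) {T : ℝ} (hT : 0 < T) :
    ∃ b : ℤ → ℝ, Summable b ∧ ∀ (ω : ℤ → ℂ), (∀ n, ‖ω n‖ ≤ 1) → ∀ (n : ℤ) (s c : ℂ), ‖s‖ ≤ S →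
      ‖c‖ ≤ R → c.re ≤ -T → ‖ω n * (n + s) ^ j * Complex.exp (c * (n + s) ^ 2)‖ ≤ b n := by
  have hs := (summable_pow_mul_jacobiTheta₂_term_bound ((1 + 2 * R * S) / (2 * π))
    (div_pos hT pi_pos) 0).mul_left (j.factorial * Real.exp (S + R * S ^ 2))
  refine ⟨_, hs, fun ω hω n s c hsS hc hcT => ?_⟩
  have hS : 0 ≤ S := (norm_nonneg s).trans hsS
  have hR : 0 ≤ R := (norm_nonneg c).trans hc
  have h1 : ‖((n : ℂ) + s) ^ j‖ ≤ j.factorial * Real.exp (|(n : ℝ)| + S) := by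
    have hx : ‖(n : ℂ) + s‖ ≤ |(n : ℝ)| + S := by
      refine (norm_add_le _ _).trans (add_le_add ?_ hsS)
      simp
    rw [norm_pow]
    calc ‖(n : ℂ) + s‖ ^ j ≤ (|(n : ℝ)| + S) ^ j := by gcongr
      _ ≤ _ := by
        have := Real.pow_div_factorial_le_exp (|(n : ℝ)| + S) (by positivity) j
        rwa [div_le_iff₀' (by positivity)] at this
  have h2 : ‖Complex.exp (c * (n + s) ^ 2)‖ ≤
      Real.exp (-T * (n : ℝ) ^ 2 + 2 * |(n : ℝ)| * (R * S) + R * S ^ 2) := by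
    rw [Complex.norm_exp]
    apply Real.exp_le_exp.mpr
    have e : c * (n + s) ^ 2 = ((n : ℝ) ^ 2 : ℝ) * c + ((2 * n : ℝ) : ℂ) * (c * s) + c * s ^ 2 := by
      push_cast; ring
    rw [e, Complex.add_re, Complex.add_re, Complex.re_ofReal_mul, Complex.re_ofReal_mul]
    have hcs : |(c * s).re| ≤ R * S :=
      (Complex.abs_re_le_norm _).trans (by rw [norm_mul]; gcongr)
    have hcs2 : (c * s ^ 2).re ≤ R * S ^ 2 :=
      (Complex.re_le_norm _).trans (by rw [norm_mul, norm_pow]; gcongr)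
    have h3 : 2 * (n : ℝ) * (c * s).re ≤ 2 * |(n : ℝ)| * (R * S) := by
      calc 2 * (n : ℝ) * (c * s).re ≤ |2 * (n : ℝ) * (c * s).re| := le_abs_self _
        _ = 2 * |(n : ℝ)| * |(c * s).re| := by rw [abs_mul, abs_mul]; norm_num
        _ ≤ _ := by gcongr
    nlinarith [sq_nonneg (n : ℝ)]
  rw [norm_mul, norm_mul]
  calc ‖ω n‖ * ‖((n : ℂ) + s) ^ j‖ * ‖Complex.exp (c * (n + s) ^ 2)‖
      ≤ 1 * (j.factorial * Real.exp (|(n : ℝ)| + S)) *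
        Real.exp (-T * (n : ℝ) ^ 2 + 2 * |(n : ℝ)| * (R * S) + R * S ^ 2) := by
        gcongr
        exact hω n
    _ = _ := by
      rw [one_mul, pow_zero, one_mul, mul_assoc (j.factorial : ℝ), mul_assoc (j.factorial : ℝ),
        ← Real.exp_add, ← Real.exp_add]
      congr 2
      push_cast
      field_simp
      ring

theorem summable_gaussMoment {ω : ℤ → ℂ} (hω : ∀ n, ‖ω n‖ ≤ 1) (j : ℕ) (s : ℂ) {c : ℂ}
    (hc : c.re < 0) :
    Summable fun n : ℤ => ω n * (n + s) ^ j * Complex.exp (c * (n + s) ^ 2) := by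
  obtain ⟨b, hb, h⟩ := exists_summable_bound_gaussMoment j ‖s‖ ‖c‖ (neg_pos.mpr hc)
  exact hb.of_norm_bounded fun n => h ω hω n s c le_rfl le_rfl (by simp)

theorem hasDerivAt_gaussMoment_left {ω : ℤ → ℂ} (hω : ∀ n, ‖ω n‖ ≤ 1) (j : ℕ) (s : ℂ) {c : ℂ}
    (hc : c.re < 0) :
    HasDerivAt (fun s => gaussMoment ω j s c)
      (j * gaussMoment ω (j - 1) s c + 2 * c * gaussMoment ω (j + 1) s c) s := by
  obtain ⟨b, hb, h⟩ := exists_summable_bound_gaussMoment j (‖s‖ + 1) ‖c‖ (neg_pos.mpr hc)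
  have hU : IsOpen (Metric.ball s 1) := Metric.isOpen_ball
  have hs : s ∈ Metric.ball s 1 := Metric.mem_ball_self one_pos
  have hbd : ∀ (n : ℤ), ∀ w ∈ Metric.ball s 1,
      ‖ω n * (n + w) ^ j * Complex.exp (c * (n + w) ^ 2)‖ ≤ b n := fun n w hw =>
    h ω hω n w c (by
      have := norm_sub_norm_le w s
      rw [mem_ball_iff_norm] at hw
      linarith) le_rfl (by simp)
  have hterm : ∀ (n : ℤ) (w : ℂ), HasDerivAt
      (fun w => ω n * (n + w) ^ j * Complex.exp (c * (n + w) ^ 2))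
      (j * (ω n * (n + w) ^ (j - 1) * Complex.exp (c * (n + w) ^ 2)) +
        2 * c * (ω n * (n + w) ^ (j + 1) * Complex.exp (c * (n + w) ^ 2))) w := fun n w => by
    have hX : HasDerivAt (fun w : ℂ => (n : ℂ) + w) 1 w := (hasDerivAt_id w).const_add _
    refine (((hX.fun_pow j).const_mul (ω n)).mul
      ((hX.fun_pow 2).const_mul c).cexp).congr_deriv ?_
    push_cast
    ring
  have hd := Complex.hasSum_deriv_of_summable_norm hb
    (fun n w _ => (hterm n w).differentiableAt.differentiableWithinAt) hU hbd hs
  have hdiff := (Complex.differentiableOn_tsum_of_summable_norm hb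
    (fun n w _ => (hterm n w).differentiableAt.differentiableWithinAt) hU hbd).differentiableAt
    (hU.mem_nhds hs)
  refine hdiff.hasDerivAt.congr_deriv (hd.unique ?_)
  simp only [(hterm _ s).deriv]
  exact ((summable_gaussMoment hω _ s hc).hasSum.mul_left _).add
    ((summable_gaussMoment hω _ s hc).hasSum.mul_left _)

theorem hasDerivAt_gaussMoment_right {ω : ℤ → ℂ} (hω : ∀ n, ‖ω n‖ ≤ 1) (j : ℕ) (s : ℂ) {c : ℂ}
    (hc : c.re < 0) :
    HasDerivAt (fun c => gaussMoment ω j s c) (gaussMoment ω (j + 2) s c) c := by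
  have hT : 0 < -c.re / 2 := by linarith
  obtain ⟨b, hb, h⟩ := exists_summable_bound_gaussMoment j ‖s‖ (‖c‖ + -c.re / 2) hT
  have hU : IsOpen (Metric.ball c (-c.re / 2)) := Metric.isOpen_ball
  have hs : c ∈ Metric.ball c (-c.re / 2) := Metric.mem_ball_self hT
  have hbd : ∀ (n : ℤ), ∀ w ∈ Metric.ball c (-c.re / 2),
      ‖ω n * (n + s) ^ j * Complex.exp (w * (n + s) ^ 2)‖ ≤ b n := fun n w hw => by
    rw [mem_ball_iff_norm] at hw
    refine h ω hω n s w le_rfl ?_ ?_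
    · have := norm_sub_norm_le w c
      linarith
    · have := Complex.re_le_norm (w - c)
      rw [Complex.sub_re] at this
      linarith
  have hterm : ∀ (n : ℤ) (w : ℂ), HasDerivAt
      (fun w => ω n * (n + s) ^ j * Complex.exp (w * (n + s) ^ 2))
      (ω n * (n + s) ^ (j + 2) * Complex.exp (w * (n + s) ^ 2)) w := fun n w => by
    refine ((((hasDerivAt_id w).mul_const (((n : ℂ) + s) ^ 2)).cexp).const_mul
      (ω n * (n + s) ^ j)).congr_deriv ?_
    simp only [id]
    ring
  have hd := Complex.hasSum_deriv_of_summable_norm hb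
    (fun n w _ => (hterm n w).differentiableAt.differentiableWithinAt) hU hbd hs
  have hdiff := (Complex.differentiableOn_tsum_of_summable_norm hb
    (fun n w _ => (hterm n w).differentiableAt.differentiableWithinAt) hU hbd).differentiableAt
    (hU.mem_nhds hs)
  refine hdiff.hasDerivAt.congr_deriv (hd.unique ?_)
  simp only [(hterm _ c).deriv]
  exact (summable_gaussMoment hω _ s hc).hasSum

/-- The `j`-th moment of the odd Jacobi theta function with nome `exp c`, in the variable `x`. -/
noncomputable def thetaMoment (j : ℕ) (x c : ℂ) : ℂ :=
  gaussMoment (fun n => (-1) ^ n) j (1 / 2 + x) c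

theorem norm_neg_one_zpow_le (n : ℤ) : ‖(-1 : ℂ) ^ n‖ ≤ 1 := by simp

theorem thetaMoment_neg (j : ℕ) (x c : ℂ) :
    thetaMoment j (-x) c = (-1) ^ (j + 1) * thetaMoment j x c := by
  unfold thetaMoment gaussMoment
  rw [← (Equiv.subLeft (-1 : ℤ)).tsum_eq, ← tsum_mul_left]
  refine tsum_congr fun n => ?_
  have h : (((-1 - n : ℤ) : ℂ) + (1 / 2 + -x)) = -((n : ℂ) + (1 / 2 + x)) := by push_cast; ring
  have h2 : (-1 : ℂ) ^ (-1 - n) = -(-1) ^ n := by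
    rw [show -1 - n = -(1 + n) by ring, zpow_neg, ← inv_zpow, inv_neg_one,
      zpow_add₀ (by norm_num)]
    simp
  simp only [Equiv.subLeft_apply]
  rw [h, h2, neg_sq, neg_pow ((n : ℂ) + (1 / 2 + x)) j]
  ring

theorem thetaMoment_add_one (j : ℕ) (x c : ℂ) :
    thetaMoment j (x + 1) c = -thetaMoment j x c := by
  unfold thetaMoment gaussMoment
  rw [← (Equiv.subRight (1 : ℤ)).tsum_eq, ← tsum_neg]
  refine tsum_congr fun n => ?_
  have h : (((n - 1 : ℤ) : ℂ) + (1 / 2 + (x + 1))) = (n : ℂ) + (1 / 2 + x) := by push_cast; ring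
  simp only [Equiv.subRight_apply]
  rw [h, zpow_sub₀ (by norm_num), zpow_one, div_neg, div_one]
  ring

theorem thetaMoment_zero_zero (c : ℂ) : thetaMoment 0 0 c = 0 := by
  have := thetaMoment_neg 0 0 c
  norm_num at this
  exact self_eq_neg.mp this

theorem thetaMoment_two_zero (c : ℂ) : thetaMoment 2 0 c = 0 := by
  have := thetaMoment_neg 2 0 c
  norm_num at this
  exact self_eq_neg.mp this

theorem hasDerivAt_thetaMoment {c : ℂ} (hc : c.re < 0) (j : ℕ) (x : ℂ) :
    HasDerivAt (fun x => thetaMoment j x c)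
      (j * thetaMoment (j - 1) x c + 2 * c * thetaMoment (j + 1) x c) x :=
  (hasDerivAt_gaussMoment_left norm_neg_one_zpow_le j (1 / 2 + x) hc).comp_const_add _ _

/-- Pairs of integers, split according to the parity of their difference. -/
def paritySplit : (ℤ × ℤ) ⊕ (ℤ × ℤ) ≃ ℤ × ℤ where
  toFun := Sum.elim (fun a => (a.1 + a.2, a.1 - a.2)) (fun a => (a.1 + a.2, a.1 - a.2 - 1))
  invFun b := if (b.1 - b.2) % 2 = 0 then Sum.inl ((b.1 + b.2) / 2, (b.1 - b.2) / 2)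
    else Sum.inr ((b.1 + b.2 + 1) / 2, (b.1 - b.2 - 1) / 2)
  left_inv := by
    rintro (⟨a, b⟩ | ⟨a, b⟩)
    · refine (if_pos (by simp only [Sum.elim_inl]; lia)).trans ?_
      simp only [Sum.elim_inl, Sum.inl.injEq, Prod.mk.injEq]
      lia
    · refine (if_neg (by simp only [Sum.elim_inr]; lia)).trans ?_
      simp only [Sum.elim_inr, Sum.inr.injEq, Prod.mk.injEq]
      lia
  right_inv := by
    rintro ⟨a, b⟩
    simp only
    split_ifs with h
    · simp only [Sum.elim_inl, Prod.mk.injEq]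
      lia
    · simp only [Sum.elim_inr, Prod.mk.injEq]
      lia

theorem thetaMoment_add_mul_sub {c : ℂ} (hc : c.re < 0) (x y : ℂ) :
    thetaMoment 0 (x + y) c * thetaMoment 0 (x - y) c =
      gaussMoment 1 0 (1 / 2 + x) (2 * c) * gaussMoment 1 0 y (2 * c) -
        gaussMoment 1 0 x (2 * c) * gaussMoment 1 0 (1 / 2 + y) (2 * c) := by
  have h1 : ∀ n : ℤ, ‖(1 : ℤ → ℂ) n‖ ≤ 1 := by simp
  have hc2 : (2 * c).re < 0 := by simp; linarith
  have hS (s : ℂ) := (summable_gaussMoment norm_neg_one_zpow_le 0 s hc).norm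
  have hG (s : ℂ) := (summable_gaussMoment h1 0 s hc2).norm
  have hL := (summable_mul_of_summable_norm (hS (1 / 2 + (x + y)))
    (hS (1 / 2 + (x - y)))).hasSum
  have hE := (summable_mul_of_summable_norm (hG (1 / 2 + x)) (hG y)).hasSum
  have hO := (summable_mul_of_summable_norm (hG x) (hG (1 / 2 + y))).hasSum.neg
  rw [← tsum_mul_tsum_of_summable_norm (hS _) (hS _)] at hL
  rw [← tsum_mul_tsum_of_summable_norm (hG _) (hG _)] at hE hO
  rw [← paritySplit.hasSum_iff] at hL
  refine (hL.unique (HasSum.sum (?_ : HasSum _ (gaussMoment 1 0 (1 / 2 + x) (2 * c) * gaussMoment 1 0 y (2 * c)))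
    (?_ : HasSum _ (-(gaussMoment 1 0 x (2 * c) * gaussMoment 1 0 (1 / 2 + y) (2 * c)))))).trans (sub_eq_add_neg _ _).symm
  · refine (Eq.subst (motive := fun f => HasSum f _) (funext ?_) hE)
    rintro ⟨j, k⟩
    symm
    simp only [Function.comp, paritySplit, Equiv.coe_fn_mk, Sum.elim_inl, pow_zero, mul_one,
      Pi.one_apply, one_mul]
    rw [mul_mul_mul_comm, ← Complex.exp_add, ← Complex.exp_add, ← zpow_add₀ (by norm_num),
      Even.neg_one_zpow ⟨j, by ring⟩, one_mul]
    congr 1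
    push_cast
    ring
  · refine (Eq.subst (motive := fun f => HasSum f _) (funext ?_) hO)
    rintro ⟨j, k⟩
    symm
    simp only [Function.comp, paritySplit, Equiv.coe_fn_mk, Sum.elim_inr, pow_zero, mul_one,
      Pi.one_apply, one_mul]
    rw [mul_mul_mul_comm, ← Complex.exp_add, ← Complex.exp_add, ← zpow_add₀ (by norm_num),
      Odd.neg_one_zpow ⟨j - 1, by ring⟩, neg_one_mul]
    congr 2
    push_cast
    ring

/-- Weierstrass' three-term relation. -/
theorem thetaMoment_three_term {c : ℂ} (hc : c.re < 0) (x y z w : ℂ) :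
    thetaMoment 0 (x + y) c * thetaMoment 0 (x - y) c *
        (thetaMoment 0 (z + w) c * thetaMoment 0 (z - w) c) -
      thetaMoment 0 (x + z) c * thetaMoment 0 (x - z) c *
        (thetaMoment 0 (y + w) c * thetaMoment 0 (y - w) c) +
      thetaMoment 0 (x + w) c * thetaMoment 0 (x - w) c *
        (thetaMoment 0 (y + z) c * thetaMoment 0 (y - z) c) = 0 := by
  simp only [thetaMoment_add_mul_sub hc]
  ring

/-- The sum of four logarithmic derivatives of theta at points adding up to zero is a product. -/
theorem thetaMoment_four_term {c : ℂ} (hc : c.re < 0) (x y z w : ℂ) (h : x + y + z + w = 0) :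
    (thetaMoment 1 x c * thetaMoment 0 y c + thetaMoment 0 x c * thetaMoment 1 y c) *
        (thetaMoment 0 z c * thetaMoment 0 w c) +
      thetaMoment 0 x c * thetaMoment 0 y c *
        (thetaMoment 1 z c * thetaMoment 0 w c + thetaMoment 0 z c * thetaMoment 1 w c) =
      -(thetaMoment 1 0 c * thetaMoment 0 (x + y) c * thetaMoment 0 (x + z) c *
        thetaMoment 0 (y + z) c) := by
  have hc0 : c ≠ 0 := fun h => by simp [h] at hc
  have h1 : ∀ n : ℤ, ‖(1 : ℤ → ℂ) n‖ ≤ 1 := by simp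
  have hc2 : (2 * c).re < 0 := by simp; linarith
  set A : ℂ → ℂ := fun x => gaussMoment 1 0 x (2 * c)
  set B : ℂ → ℂ := fun x => gaussMoment 1 0 (1 / 2 + x) (2 * c)
  obtain ⟨A', hA⟩ : ∃ A' : ℂ → ℂ, ∀ x, HasDerivAt A (A' x) x :=
    ⟨_, fun x => hasDerivAt_gaussMoment_left h1 0 x hc2⟩
  obtain ⟨B', hB⟩ : ∃ B' : ℂ → ℂ, ∀ x, HasDerivAt B (B' x) x :=
    ⟨_, fun x => (hasDerivAt_gaussMoment_left h1 0 (1 / 2 + x) hc2).comp_const_add _ _⟩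
  have hT (u v : ℂ) : thetaMoment 0 (u + v) c * thetaMoment 0 (u - v) c = B u * A v - A u * B v :=
    thetaMoment_add_mul_sub hc u v
  have hD (u v : ℂ) : 2 * c * (thetaMoment 1 (u + v) c * thetaMoment 0 (u - v) c +
      thetaMoment 0 (u + v) c * thetaMoment 1 (u - v) c) = B' u * A v - A' u * B v := by
    have h2 := ((hasDerivAt_thetaMoment hc 0 (u + v)).comp_add_const u v).mul
      ((hasDerivAt_thetaMoment hc 0 (u - v)).comp_sub_const u v)
    have h3 := ((hB u).mul_const (A v)).sub ((hA u).mul_const (B v))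
    have h4 := h2.unique (h3.congr_of_eventuallyEq (Filter.Eventually.of_forall fun u => hT u v))
    rw [← h4]
    push_cast
    ring
  set u := (x + y) / 2
  have e1 : x = u + (x - y) / 2 := by ring
  have e2 : y = u - (x - y) / 2 := by ring
  have e3 : z = -(u + (-z - u)) := by ring
  have e4 : w = -(u - (-z - u)) := by rw [show w = -x - y - z by linear_combination h]; ring
  have e5 : x + z = (x - y) / 2 - (-z - u) := by ring
  have e6 : y + z = -((x - y) / 2 + (-z - u)) := by ring
  have e7 : x + y = u + u := by ring
  have hW : 2 * c * (thetaMoment 0 (x + y) c * thetaMoment 1 0 c) = B' u * A u - A' u * B u := by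
    rw [← hD u u, sub_self, thetaMoment_zero_zero, e7]
    ring
  have hTyz := hT ((x - y) / 2) (-z - u)
  have hTx := hT u ((x - y) / 2)
  have hDx := hD u ((x - y) / 2)
  have hTz := hT u (-z - u)
  have hDz := hD u (-z - u)
  rw [← e1, ← e2] at hTx hDx
  have f3 : u + (-z - u) = -z := by ring
  have f4 : u - (-z - u) = -w := by rw [e4, neg_neg]
  have f6 : (x - y) / 2 + (-z - u) = -(y + z) := by rw [e6, neg_neg]
  simp only [f3, f4, f6, ← e5, thetaMoment_neg] at hTyz hTz hDz
  norm_num at hTyz hTz hDz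
  apply mul_left_cancel₀ (mul_ne_zero two_ne_zero hc0)
  linear_combination thetaMoment 0 z c * thetaMoment 0 w c * hDx + (B' u * A ((x - y) / 2) - A' u * B ((x - y) / 2)) * hTz
    - (thetaMoment 0 x c * thetaMoment 0 y c) * hDz - hTx * (B' u * A (-z - u) - A' u * B (-z - u)) + thetaMoment 0 (x + z) c * thetaMoment 0 (y + z) c * hW - (B' u * A u - A' u * B u) * hTyz

/-- The second derivative at the origin of `thetaMoment_four_term`. -/
theorem thetaMoment_quadratic {c : ℂ} (hc : c.re < 0) (x y z : ℂ) (h : x + y + z = 0) :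
    thetaMoment 3 0 c * (thetaMoment 0 x c * thetaMoment 0 y c * thetaMoment 0 z c) =
      thetaMoment 1 0 c * (thetaMoment 2 x c * thetaMoment 0 y c * thetaMoment 0 z c +
        thetaMoment 0 x c * thetaMoment 2 y c * thetaMoment 0 z c +
        thetaMoment 0 x c * thetaMoment 0 y c * thetaMoment 2 z c +
        2 * (thetaMoment 1 x c * thetaMoment 1 y c * thetaMoment 0 z c +
          thetaMoment 1 x c * thetaMoment 0 y c * thetaMoment 1 z c +
          thetaMoment 0 x c * thetaMoment 1 y c * thetaMoment 1 z c)) := by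
  have hc0 : c ≠ 0 := fun h => by simp [h] at hc
  have hz : z = -x - y := by linear_combination h
  set T : ℕ → ℂ → ℂ := fun j x => thetaMoment j x c
  have hT (j : ℕ) (x : ℂ) : HasDerivAt (T j) (j * T (j - 1) x + 2 * c * T (j + 1) x) x :=
    hasDerivAt_thetaMoment hc j x
  have hE (j : ℕ) (d : ℂ) : HasDerivAt (fun d => T j (z - d))
      (-(j * T (j - 1) (z - d) + 2 * c * T (j + 1) (z - d))) d :=
    (hT j (z - d)).comp_const_sub z d
  have hA (j : ℕ) (a d : ℂ) : HasDerivAt (fun d => T j (a + d))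
      (j * T (j - 1) (a + d) + 2 * c * T (j + 1) (a + d)) d :=
    (hT j (a + d)).comp_const_add a d
  have h0 (d : ℂ) := thetaMoment_four_term hc x y d (z - d) (by rw [hz]; ring)
  have h1 (d : ℂ) : (T 1 x * T 0 y + T 0 x * T 1 y) * (T 1 d * T 0 (z - d) - T 0 d * T 1 (z - d)) +
      T 0 x * T 0 y * (T 2 d * T 0 (z - d) - T 0 d * T 2 (z - d)) =
      -(T 1 0 * T 0 (x + y) * (T 1 (x + d) * T 0 (y + d) + T 0 (x + d) * T 1 (y + d))) := by
    have h2 := ((((hT 0 d).mul (hE 0 d)).const_mul (T 1 x * T 0 y + T 0 x * T 1 y)).add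
      ((((hT 1 d).mul (hE 0 d)).add ((hT 0 d).mul (hE 1 d))).const_mul (T 0 x * T 0 y))).unique
      (((((hA 0 x d).const_mul (T 1 0 * T 0 (x + y))).mul (hA 0 y d)).neg).congr_of_eventuallyEq
        (Filter.Eventually.of_forall h0))
    norm_num at h2
    apply mul_left_cancel₀ (mul_ne_zero two_ne_zero hc0)
    linear_combination h2
  have h3 := (((((hT 1 0).mul (hE 0 0)).sub ((hT 0 0).mul (hE 1 0))).const_mul
      (T 1 x * T 0 y + T 0 x * T 1 y)).add
    ((((hT 2 0).mul (hE 0 0)).sub ((hT 0 0).mul (hE 2 0))).const_mul (T 0 x * T 0 y))).unique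
    (((((hA 1 x 0).mul (hA 0 y 0)).add ((hA 0 x 0).mul (hA 1 y 0))).const_mul
      (T 1 0 * T 0 (x + y))).neg.congr_of_eventuallyEq (Filter.Eventually.of_forall h1))
  have e0 : T 0 0 = 0 := thetaMoment_zero_zero c
  have e2 : T 2 0 = 0 := thetaMoment_two_zero c
  have ez : T 0 (x + y) = -T 0 z := by
    rw [show x + y = -z by rw [hz]; ring]
    simp [T, thetaMoment_neg]
  norm_num [e0, e2, ez] at h3
  apply mul_left_cancel₀ (mul_ne_zero two_ne_zero hc0)
  change 2 * c * (T 3 0 * (T 0 x * T 0 y * T 0 z)) = 2 * c * (T 1 0 * (T 2 x * T 0 y * T 0 z +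
        T 0 x * T 2 y * T 0 z + T 0 x * T 0 y * T 2 z + 2 * (T 1 x * T 1 y * T 0 z +
          T 1 x * T 0 y * T 1 z + T 0 x * T 1 y * T 1 z)))
  linear_combination h3

/-- The finite product `(p; p)ₙ` with `p = exp (2c)`. -/
noncomputable def nomeProd (c : ℂ) (n : ℕ) : ℂ :=
  ∏ i ∈ Finset.range n, (1 - Complex.exp (2 * c * (i + 1)))

theorem nomeProd_succ (c : ℂ) (n : ℕ) :
    nomeProd c (n + 1) = nomeProd c n * (1 - Complex.exp (2 * c * (n + 1))) :=
  Finset.prod_range_succ _ _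

theorem exp_two_mul_re_neg {c : ℂ} (hc : c.re < 0) (x : ℝ) (hx : 0 < x) :
    ‖Complex.exp (2 * c * x)‖ < 1 := by
  rw [Complex.norm_exp, Real.exp_lt_one_iff]
  simp only [Complex.mul_re, Complex.re_ofNat, Complex.im_ofNat, zero_mul, sub_zero,
    Complex.ofReal_re, Complex.ofReal_im, mul_zero]
  nlinarith

theorem nomeProd_ne_zero {c : ℂ} (hc : c.re < 0) (n : ℕ) : nomeProd c n ≠ 0 := by
  refine Finset.prod_ne_zero_iff.mpr fun i _ h => ?_
  have h1 := exp_two_mul_re_neg hc (i + 1) (by positivity)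
  push_cast at h1
  rw [← sub_eq_zero.mp h, norm_one] at h1
  exact lt_irrefl _ h1

/-- The `q`-binomial theorem. -/
theorem prod_one_add_mul_exp {c : ℂ} (hc : c.re < 0) (M : ℕ) (y : ℂ) :
    ∏ i ∈ Finset.range M, (1 + y * Complex.exp (2 * c * i)) =
      ∑ j ∈ Finset.HasAntidiagonal.antidiagonal M, nomeProd c M / (nomeProd c j.1 * nomeProd c j.2) *
        Complex.exp (c * (j.1 * (j.1 - 1))) * y ^ j.1 := by
  induction M generalizing y with
  | zero => simp [nomeProd]
  | succ M ih =>
    have e : ∏ i ∈ Finset.range (M + 1), (1 + y * Complex.exp (2 * c * i)) =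
        (∏ i ∈ Finset.range M, (1 + y * Complex.exp (2 * c) * Complex.exp (2 * c * i))) *
          (1 + y) := by
      rw [Finset.prod_range_succ']
      congr 1
      · refine Finset.prod_congr rfl fun i _ => ?_
        rw [mul_assoc y, ← Complex.exp_add]
        push_cast
        congr 3
        ring
      · simp
    rw [e, ih, mul_add, mul_one]
    set A : ℕ × ℕ → ℂ := fun j => nomeProd c M / (nomeProd c j.1 * nomeProd c j.2) *
      Complex.exp (c * (j.1 * (j.1 - 1))) * y ^ j.1 * (Complex.exp (2 * c * j.1) *
        (1 - Complex.exp (2 * c * j.2)))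
    set B : ℕ × ℕ → ℂ := fun j => nomeProd c M / (nomeProd c j.1 * nomeProd c j.2) *
      Complex.exp (c * (j.1 * (j.1 - 1))) * y ^ j.1 * (1 - Complex.exp (2 * c * j.1))
    have hAB : ∀ j ∈ Finset.HasAntidiagonal.antidiagonal (M + 1),
        nomeProd c (M + 1) / (nomeProd c j.1 * nomeProd c j.2) *
        Complex.exp (c * (j.1 * (j.1 - 1))) * y ^ j.1 = A j + B j := by
      intro j hj
      have h : (M : ℂ) + 1 = j.1 + j.2 := by
        exact_mod_cast (Finset.HasAntidiagonal.mem_antidiagonal.mp hj).symm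
      simp only [A, B]
      rw [nomeProd_succ, h, mul_add, Complex.exp_add]
      ring
    rw [Finset.sum_congr rfl hAB, Finset.sum_add_distrib,
      Finset.Nat.sum_antidiagonal_succ' (f := A), Finset.Nat.sum_antidiagonal_succ (f := B)]
    have hA0 : A (M + 1, 0) = 0 := by simp [A]
    have hB0 : B (0, M + 1) = 0 := by simp [B]
    have h1 (x : ℕ) : (1 : ℂ) - Complex.exp (2 * c * (x + 1)) ≠ 0 :=
      right_ne_zero_of_mul (nomeProd_succ c x ▸ nomeProd_ne_zero hc (x + 1))
    rw [hA0, hB0, zero_add, zero_add, Finset.sum_mul]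
    congr 1
    · refine Finset.sum_congr rfl fun j _ => ?_
      have hz := h1 j.2
      have := nomeProd_ne_zero hc j.1
      have := nomeProd_ne_zero hc j.2
      simp only [A, nomeProd_succ]
      rw [mul_pow, ← Complex.exp_nat_mul, mul_comm (j.1 : ℂ) (2 * c)]
      push_cast
      generalize Complex.exp (2 * c * ((j.2 : ℂ) + 1)) = z at hz ⊢
      field_simp
    · refine Finset.sum_congr rfl fun j _ => ?_
      have hz := h1 j.1
      have := nomeProd_ne_zero hc j.1
      have := nomeProd_ne_zero hc j.2
      simp only [B, nomeProd_succ]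
      have e2 : Complex.exp (c * ((j.1 + 1 : ℕ) * ((j.1 + 1 : ℕ) - 1))) =
          Complex.exp (c * (j.1 * (j.1 - 1))) * Complex.exp (2 * c * j.1) := by
        rw [← Complex.exp_add]
        push_cast
        congr 1
        ring
      rw [mul_pow, ← Complex.exp_nat_mul, mul_comm (j.1 : ℂ) (2 * c), e2]
      push_cast
      generalize Complex.exp (2 * c * ((j.1 : ℂ) + 1)) = z at hz ⊢
      field_simp
      ring

/-- The finite form of the Jacobi triple product identity. -/
theorem finite_triple_product {c : ℂ} (hc : c.re < 0) (N : ℕ) (t : ℂ) :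
    (∏ i ∈ Finset.range N, (1 - Complex.exp (2 * c * (t + (i + 1))))) *
      ∏ i ∈ Finset.range N, (1 - Complex.exp (2 * c * (i - t))) =
      ∑ n ∈ Finset.Icc (-N : ℤ) N,
        nomeProd c (N + N) / (nomeProd c (N + n).toNat * nomeProd c (N - n).toNat) *
          ((-1) ^ n * Complex.exp (c * (n ^ 2 + n + 2 * t * n))) := by
  have h := prod_one_add_mul_exp hc (N + N) (-Complex.exp (2 * c * (t + 1 - N)))
  rw [Finset.prod_range_add, ← Finset.prod_range_reflect] at h
  have h1 : ∏ i ∈ Finset.range N, (1 + -Complex.exp (2 * c * (t + 1 - N)) *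
      Complex.exp (2 * c * (N - 1 - i : ℕ))) = (-1) ^ N *
        Complex.exp (c * (2 * N * t - N * (N - 1))) *
          ∏ i ∈ Finset.range N, (1 - Complex.exp (2 * c * (i - t))) := by
    have h2 : ((-1) ^ N * Complex.exp (c * (2 * N * t - N * (N - 1))) : ℂ) =
        ∏ i ∈ Finset.range N, (-Complex.exp (2 * c * (t - i))) := by
      clear h
      induction N with
      | zero => simp
      | succ N ih =>
        rw [Finset.prod_range_succ, ← ih, show c * (2 * (N + 1 : ℕ) * t - (N + 1 : ℕ) *
          ((N + 1 : ℕ) - 1)) = c * (2 * N * t - N * (N - 1)) + 2 * c * (t - N) by push_cast; ring,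
          Complex.exp_add]
        ring
    rw [h2, ← Finset.prod_mul_distrib]
    refine Finset.prod_congr rfl fun i hi => ?_
    have hi' : ((N - 1 - i : ℕ) : ℂ) = N - 1 - i := by
      rw [Nat.sub_sub, Nat.cast_sub (by have := Finset.mem_range.mp hi; lia)]
      push_cast
      ring
    have e1 : Complex.exp (2 * c * (t + 1 - N)) * Complex.exp (2 * c * (N - 1 - i)) =
        Complex.exp (2 * c * (t - i)) := by
      rw [← Complex.exp_add]
      ring_nf
    have e2 : Complex.exp (2 * c * (t - i)) * Complex.exp (2 * c * (i - t)) = 1 := by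
      rw [← Complex.exp_add, ← Complex.exp_zero]
      ring_nf
    rw [hi']
    linear_combination -e1 - e2
  have h3 (i : ℕ) : 1 + -Complex.exp (2 * c * (t + 1 - N)) * Complex.exp (2 * c * (N + i : ℕ)) =
      1 - Complex.exp (2 * c * (t + (i + 1))) := by
    rw [neg_mul, ← Complex.exp_add]
    push_cast
    rw [show 2 * c * (t + 1 - N) + 2 * c * (N + i) = 2 * c * (t + (i + 1)) by ring]
    ring
  have h4 : ((-1) ^ N * Complex.exp (c * (2 * N * t - N * (N - 1))) : ℂ) ≠ 0 :=
    mul_ne_zero (pow_ne_zero _ (by norm_num)) (Complex.exp_ne_zero _)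
  rw [h1, Finset.prod_congr rfl fun i _ => h3 i] at h
  apply mul_left_cancel₀ h4
  calc _ = _ := by ring
    _ = _ := h
    _ = _ := ?_
  rw [Finset.mul_sum]
  refine Finset.sum_bij' (fun j _ => (j.1 : ℤ) - N) (fun n _ => ((N + n).toNat, (N - n).toNat))
    ?_ ?_ ?_ ?_ ?_
  · intro j hj
    have := Finset.HasAntidiagonal.mem_antidiagonal.mp hj
    rw [Finset.mem_Icc]
    lia
  · intro n hn
    have := Finset.mem_Icc.mp hn
    rw [Finset.HasAntidiagonal.mem_antidiagonal]
    lia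
  · rintro ⟨a, b⟩ hj
    have := Finset.HasAntidiagonal.mem_antidiagonal.mp hj
    ext <;> simp only <;> lia
  · intro n hn
    have := Finset.mem_Icc.mp hn
    simp only
    lia
  · rintro ⟨a, b⟩ hj
    have := Finset.HasAntidiagonal.mem_antidiagonal.mp hj
    simp only
    rw [show (N + ((a : ℤ) - N)).toNat = a by lia, show (N - ((a : ℤ) - N)).toNat = b by lia,
      neg_pow (Complex.exp _), ← Complex.exp_nat_mul, zpow_sub₀ (by norm_num), zpow_natCast,
      zpow_natCast]
    have e1 : ((-1 : ℂ) ^ N) ≠ 0 := pow_ne_zero _ (by norm_num)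
    have e2 : Complex.exp (c * (2 * N * t - N * (N - 1))) *
        Complex.exp (c * (((a - N : ℤ) : ℂ) ^ 2 + (a - N : ℤ) + 2 * t * (a - N : ℤ))) =
        Complex.exp (c * (a * (a - 1))) * Complex.exp (a * (2 * c * (t + 1 - N))) := by
      rw [← Complex.exp_add, ← Complex.exp_add]
      push_cast
      congr 1
      ring
    have e3 : (-1 : ℂ) ^ N * ((-1) ^ a / (-1) ^ N) = (-1) ^ a := mul_div_cancel₀ _ e1
    set K := nomeProd c (N + N) / (nomeProd c a * nomeProd c b)
    linear_combination (-K * (-1) ^ a) * e2 - K * Complex.exp (c * (2 * N * t - N * (N - 1))) *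
        Complex.exp (c * (((a - N : ℤ) : ℂ) ^ 2 + (a - N : ℤ) + 2 * t * (a - N : ℤ))) * e3

/-- The product `∏ₙ (1 - exp (2c(a + n)))`. -/
noncomputable def expProd (a c : ℂ) : ℂ :=
  ∏' n : ℕ, (1 - Complex.exp (2 * c * (a + n)))

theorem exp_geometric (a c : ℂ) (n : ℕ) :
    Complex.exp (2 * c * (a + n)) = Complex.exp (2 * c * a) * Complex.exp (2 * c) ^ n := by
  rw [← Complex.exp_nat_mul, ← Complex.exp_add]
  ring_nf

theorem norm_exp_two_mul_lt_one {c : ℂ} (hc : c.re < 0) : ‖Complex.exp (2 * c)‖ < 1 := by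
  simpa using exp_two_mul_re_neg hc 1 one_pos

theorem summable_norm_exp (a : ℂ) {c : ℂ} (hc : c.re < 0) :
    Summable fun n : ℕ => ‖Complex.exp (2 * c * (a + n))‖ := by
  simp only [exp_geometric, norm_mul, norm_pow]
  exact (summable_geometric_of_lt_one (norm_nonneg _) (norm_exp_two_mul_lt_one hc)).mul_left _

theorem multipliable_expProd (a : ℂ) {c : ℂ} (hc : c.re < 0) :
    Multipliable fun n : ℕ => 1 - Complex.exp (2 * c * (a + n)) := by
  simp only [sub_eq_add_neg]
  exact Complex.multipliable_one_add_of_summable (summable_norm_exp a hc).of_norm.neg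

theorem tendsto_expProd (a : ℂ) {c : ℂ} (hc : c.re < 0) :
    Tendsto (fun N => ∏ n ∈ Finset.range N, (1 - Complex.exp (2 * c * (a + n)))) atTop
      (𝓝 (expProd a c)) :=
  (multipliable_expProd a hc).hasProd.tendsto_prod_nat

theorem expProd_eq_mul (a : ℂ) {c : ℂ} (hc : c.re < 0) :
    expProd a c = (1 - Complex.exp (2 * c * a)) * expProd (a + 1) c := by
  refine tendsto_nhds_unique ((tendsto_add_atTop_iff_nat 1).mpr (tendsto_expProd a hc)) ?_
  refine ((tendsto_expProd (a + 1) hc).const_mul (1 - Complex.exp (2 * c * a))).congr fun N => ?_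
  rw [Finset.prod_range_succ', mul_comm]
  push_cast
  rw [add_zero]
  congr 1
  refine Finset.prod_congr rfl fun i _ => ?_
  ring_nf

theorem expProd_ne_zero {c : ℂ} (hc : c.re < 0) {a : ℝ} (ha : 0 < a) : expProd a c ≠ 0 := by
  unfold expProd
  simp only [sub_eq_add_neg]
  refine tprod_one_add_ne_zero_of_summable (fun n h => ?_) ?_
  · have h1 := exp_two_mul_re_neg hc (a + n) (by positivity)
    push_cast at h1
    rw [add_neg_eq_zero.mp h |>.symm, norm_one] at h1
    exact lt_irrefl _ h1
  · simpa using summable_norm_exp a hc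

theorem continuousAt_expProd (a : ℂ) {c : ℂ} (hc : c.re < 0) :
    ContinuousAt (fun a => expProd a c) a := by
  obtain ⟨K, hK⟩ : ∃ K, ∀ᶠ x in 𝓝 a, ‖Complex.exp (2 * c * x)‖ ≤ K := by
    refine ⟨‖Complex.exp (2 * c * a)‖ + 1, ?_⟩
    have : ContinuousAt (fun x => ‖Complex.exp (2 * c * x)‖) a := by fun_prop
    exact (this.eventually_lt continuousAt_const (lt_add_one _)).mono fun _ h => h.le
  have hs : Summable fun n : ℕ => K * ‖Complex.exp (2 * c)‖ ^ n :=
    (summable_geometric_of_lt_one (norm_nonneg _) (norm_exp_two_mul_lt_one hc)).mul_left _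
  simp only [ContinuousAt, expProd, sub_eq_add_neg]
  refine tendsto_tprod_one_add_of_dominated_convergence hs (fun n => ?_) ?_
  · have : ContinuousAt (fun x => -Complex.exp (2 * c * (x + n))) a := by fun_prop
    exact this
  · filter_upwards [hK] with x hx n
    rw [norm_neg, exp_geometric, norm_mul, norm_pow]
    gcongr

theorem tendsto_expProd_one {a : ℝ} (ha : 0 < a) {l : Filter ℂ}
    (hl : Tendsto Complex.re l atBot) : Tendsto (fun c => expProd a c) l (𝓝 1) := by
  have hs : Summable fun n : ℕ => Real.exp (-1) ^ n :=
    summable_geometric_of_lt_one (Real.exp_pos _).le (Real.exp_lt_one_iff.mpr (by norm_num))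
  have hn (n : ℕ) (c : ℂ) : ‖-Complex.exp (2 * c * (a + n))‖ = Real.exp (2 * (a + n) * c.re) := by
    rw [norm_neg, Complex.norm_exp, ← Complex.ofReal_natCast, ← Complex.ofReal_add,
      show 2 * c * ((a + n : ℝ) : ℂ) = ((2 * (a + n) : ℝ) : ℂ) * c by push_cast; ring,
      Complex.re_ofReal_mul]
  have h1 : (1 : ℂ) = ∏' n : ℕ, (1 + (0 : ℂ)) := by simp
  rw [h1]
  simp only [expProd, sub_eq_add_neg]
  refine tendsto_tprod_one_add_of_dominated_convergence hs (fun n => ?_) ?_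
  · rw [tendsto_zero_iff_norm_tendsto_zero]
    simp only [hn]
    exact Real.tendsto_exp_atBot.comp (hl.const_mul_atBot (by positivity))
  · filter_upwards [hl.eventually_le_atBot (-1)] with c hc n
    rw [hn, ← Real.exp_nat_mul]
    apply Real.exp_le_exp.mpr
    have : (0 : ℝ) ≤ n := by positivity
    nlinarith

theorem nomeProd_eq (c : ℂ) (n : ℕ) :
    nomeProd c n = ∏ i ∈ Finset.range n, (1 - Complex.exp (2 * c * (1 + i))) := by
  simp only [nomeProd, add_comm]

/-- The Jacobi triple product identity. -/
theorem thetaMoment_zero_eq_prod {c : ℂ} (hc : c.re < 0) (t : ℂ) :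
    thetaMoment 0 t c = Complex.exp (c * (1 / 2 + t) ^ 2) *
      (expProd 1 c * (expProd (t + 1) c * expProd (-t) c)) := by
  have hE : Tendsto (nomeProd c) atTop (𝓝 (expProd 1 c)) := by
    simpa only [← nomeProd_eq] using tendsto_expProd 1 hc
  have hE0 : expProd 1 c ≠ 0 := by exact_mod_cast expProd_ne_zero hc one_pos
  have hEi := hE.inv₀ hE0
  obtain ⟨K, hK⟩ := (Metric.isBounded_range_of_tendsto _ hE).exists_norm_le
  obtain ⟨L, hL⟩ := (Metric.isBounded_range_of_tendsto _ hEi).exists_norm_le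
  have hK' (n : ℕ) : ‖nomeProd c n‖ ≤ K := hK _ ⟨n, rfl⟩
  have hL' (n : ℕ) : ‖(nomeProd c n)⁻¹‖ ≤ L := hL _ ⟨n, rfl⟩
  have hK0 : 0 ≤ K := (norm_nonneg _).trans (hK' 0)
  have hL0 : 0 ≤ L := (norm_nonneg _).trans (hL' 0)
  set term : ℤ → ℂ := fun n => (-1) ^ n * Complex.exp (c * (n ^ 2 + n + 2 * t * n))
  have hterm (n : ℤ) : (-1) ^ n * (n + (1 / 2 + t)) ^ 0 * Complex.exp (c * (n + (1 / 2 + t)) ^ 2) =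
      Complex.exp (c * (1 / 2 + t) ^ 2) * term n := by
    simp only [term]
    rw [show c * (n + (1 / 2 + t)) ^ 2 = c * (1 / 2 + t) ^ 2 + c * (n ^ 2 + n + 2 * t * n) by ring,
      Complex.exp_add]
    ring
  have hsum : Summable fun n => ‖term n‖ := by
    have := (summable_gaussMoment norm_neg_one_zpow_le 0 (1 / 2 + t) hc).norm
    simp only [hterm, norm_mul] at this
    exact (summable_mul_left_iff (norm_ne_zero_iff.mpr (Complex.exp_ne_zero _))).mp this
  have hlim : Tendsto (fun N : ℕ => ∑' n : ℤ, (if n ∈ Finset.Icc (-N : ℤ) N then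
      nomeProd c (N + N) / (nomeProd c (N + n).toNat * nomeProd c (N - n).toNat) * term n else 0))
      atTop (𝓝 (∑' n : ℤ, (expProd 1 c)⁻¹ * term n)) := by
    refine tendsto_tsum_of_dominated_convergence (hsum.mul_left (K * (L * L))) (fun n => ?_) ?_
    · have h1 : Tendsto (fun N : ℕ => (N + n).toNat) atTop atTop :=
        tendsto_atTop.mpr fun b => (eventually_ge_atTop (b + n.natAbs)).mono fun N h => by lia
      have h2 : Tendsto (fun N : ℕ => (N - n).toNat) atTop atTop :=
        tendsto_atTop.mpr fun b => (eventually_ge_atTop (b + n.natAbs)).mono fun N h => by lia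
      have h3 : Tendsto (fun N : ℕ => N + N) atTop atTop :=
        tendsto_atTop.mpr fun b => (eventually_ge_atTop b).mono fun N h => by lia
      have h4 := ((hE.comp h3).div ((hE.comp h1).mul (hE.comp h2))
        (mul_ne_zero hE0 hE0)).mul_const (term n)
      have h5 : expProd 1 c / (expProd 1 c * expProd 1 c) = (expProd 1 c)⁻¹ := by field_simp
      rw [h5] at h4
      refine h4.congr' ?_
      filter_upwards [eventually_ge_atTop n.natAbs] with N hN
      rw [if_pos (Finset.mem_Icc.mpr (by lia))]
      rfl
    · refine Eventually.of_forall fun N n => ?_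
      split_ifs
      · rw [norm_mul, div_eq_mul_inv, mul_inv, norm_mul, norm_mul]
        gcongr
        exacts [hK' _, hL' _, hL' _]
      · rw [norm_zero]
        positivity
  have hfin : Tendsto (fun N : ℕ => (∏ i ∈ Finset.range N, (1 - Complex.exp (2 * c * (t + 1 + i)))) *
      ∏ i ∈ Finset.range N, (1 - Complex.exp (2 * c * (-t + i)))) atTop
      (𝓝 (∑' n : ℤ, (expProd 1 c)⁻¹ * term n)) := by
    refine hlim.congr fun N => ?_
    rw [tsum_eq_sum (s := Finset.Icc (-N : ℤ) N) fun n hn => if_neg hn,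
      Finset.sum_congr rfl fun n hn => if_pos hn, ← finite_triple_product hc]
    congr 1 <;> refine Finset.prod_congr rfl fun i _ => ?_ <;> ring_nf
  have h := tendsto_nhds_unique hfin ((tendsto_expProd (t + 1) hc).mul (tendsto_expProd (-t) hc))
  rw [← h, tsum_mul_left, mul_inv_cancel_left₀ hE0, ← tsum_mul_left]
  exact tsum_congr hterm

/-- The derivative of theta at the origin is a cube. -/
theorem thetaMoment_one_zero_eq_prod {c : ℂ} (hc : c.re < 0) :
    thetaMoment 1 0 c = Complex.exp (c / 4) * expProd 1 c ^ 3 := by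
  have hc0 : c ≠ 0 := fun h => by simp [h] at hc
  have h1 := hasDerivAt_thetaMoment hc 0 0
  set F : ℂ → ℂ := fun t => Complex.exp (c * (1 / 2 + t) ^ 2) *
    (expProd 1 c * (expProd (t + 1) c * expProd (-t + 1) c))
  have hF : ContinuousAt F 0 := by
    have e1 : ContinuousAt (fun t => expProd (t + 1) c) 0 :=
      ContinuousAt.comp (g := fun a => expProd a c) (continuousAt_expProd _ hc) (by fun_prop)
    have e2 : ContinuousAt (fun t => expProd (-t + 1) c) 0 :=
      ContinuousAt.comp (g := fun a => expProd a c) (continuousAt_expProd _ hc) (by fun_prop)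
    fun_prop
  have hTF (t : ℂ) : thetaMoment 0 t c = (1 - Complex.exp (2 * c * (-t))) * F t := by
    rw [thetaMoment_zero_eq_prod hc, expProd_eq_mul (-t) hc]
    ring
  have hg : HasDerivAt (fun t : ℂ => 1 - Complex.exp (2 * c * (-t))) (2 * c) 0 := by
    refine ((((hasDerivAt_neg (0 : ℂ)).const_mul (2 * c)).cexp).const_sub 1).congr_deriv ?_
    simp
  have h2 : HasDerivAt (fun t => thetaMoment 0 t c) (2 * c * F 0) 0 := by
    rw [hasDerivAt_iff_tendsto_slope_zero] at hg ⊢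
    refine (hg.mul (hF.tendsto.mono_left nhdsWithin_le_nhds)).congr fun t => ?_
    simp only [zero_add, hTF, neg_zero, mul_zero, Complex.exp_zero, sub_self, zero_mul, sub_zero,
      smul_eq_mul]
    ring
  have h3 := h1.unique h2
  have h4 : F 0 = Complex.exp (c / 4) * expProd 1 c ^ 3 := by
    simp only [F, neg_zero, zero_add, add_zero]
    ring_nf
  rw [← h4]
  apply mul_left_cancel₀ (mul_ne_zero two_ne_zero hc0)
  simpa using h3

theorem prod_range_mul_eq {M : Type*} [CommMonoid M] (f : ℕ → M) (N m : ℕ) :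
    ∏ i ∈ Finset.range (N * m), f i = ∏ k ∈ Finset.range m, ∏ j ∈ Finset.range N, f (N * k + j) := by
  induction m with
  | zero => simp
  | succ m ih => rw [Nat.mul_succ, Finset.prod_range_add, Finset.prod_range_succ, ih]

theorem tendsto_mul_left_atTop {N : ℕ} (hN : 0 < N) : Tendsto (fun m : ℕ => N * m) atTop atTop :=
  tendsto_id.const_mul_atTop' hN

/-- Splitting of a product according to residues modulo `N`. -/
theorem expProd_split {c : ℂ} (hc : c.re < 0) {N : ℕ} (hN : 0 < N) (a : ℂ) :
    expProd (N * a) (c / N) = ∏ j ∈ Finset.range N, expProd (a + j / N) c := by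
  have hN0 : (N : ℂ) ≠ 0 := by exact_mod_cast hN.ne'
  have hcN : (c / N).re < 0 := by
    rw [Complex.div_natCast_re]
    exact div_neg_of_neg_of_pos hc (by exact_mod_cast hN)
  refine tendsto_nhds_unique ((tendsto_expProd (N * a) hcN).comp (tendsto_mul_left_atTop hN)) ?_
  refine (tendsto_finsetProd _ fun (j : ℕ) _ => tendsto_expProd (a + j / N) hc).congr fun m => ?_
  rw [Function.comp_apply, prod_range_mul_eq, Finset.prod_comm]
  refine Finset.prod_congr rfl fun k _ => Finset.prod_congr rfl fun j _ => ?_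
  congr 2
  push_cast
  field_simp
  ring

theorem multipliable_siegelProd {q : ℂ} (hq : ‖q‖ < 1) (a : ℕ) : Multipliable fun n : ℕ =>
    (if (n + 1) % 15 = a ∨ (n + 1) % 15 = 15 - a then 1 - q ^ (n + 1) else 1) := by
  have h (n : ℕ) : (if (n + 1) % 15 = a ∨ (n + 1) % 15 = 15 - a then 1 - q ^ (n + 1) else 1) =
      1 + (if (n + 1) % 15 = a ∨ (n + 1) % 15 = 15 - a then -q ^ (n + 1) else 0) := by
    split_ifs <;> ring
  simp only [h]
  apply Complex.multipliable_one_add_of_summable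
  refine (summable_geometric_of_lt_one (norm_nonneg q) hq).of_norm_bounded fun n => ?_
  split_ifs
  · rw [norm_neg, norm_pow]
    exact pow_le_pow_of_le_one (norm_nonneg _) hq.le n.le_succ
  · rw [norm_zero]
    positivity

theorem siegelProd_eq_s11 {c : ℂ} (hc : c.re < 0) {a : ℕ} (h1 : 1 ≤ a) (h7 : a ≤ 7) :
    siegelProd (Complex.exp (2 * c / 15)) a =
      expProd (a / 15) c * expProd ((15 - a : ℕ) / 15) c := by
  have hc15 : (c / 15).re < 0 := by
    rw [show (15 : ℂ) = (15 : ℕ) by norm_num, Complex.div_natCast_re]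
    exact div_neg_of_neg_of_pos hc (by norm_num)
  have hq : ‖Complex.exp (2 * c / 15)‖ < 1 := by
    rw [mul_div_assoc]
    exact norm_exp_two_mul_lt_one hc15
  refine tendsto_nhds_unique ((multipliable_siegelProd hq a).hasProd.tendsto_prod_nat.comp
    (tendsto_mul_left_atTop (N := 15) (by norm_num))) ?_
  refine ((tendsto_expProd (a / 15) hc).mul
    (tendsto_expProd ((15 - a : ℕ) / 15) hc)).congr fun m => ?_
  rw [Function.comp_apply, prod_range_mul_eq, ← Finset.prod_mul_distrib]
  refine Finset.prod_congr rfl fun k _ => ?_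
  have he (b : ℕ) : Complex.exp (2 * c * ((b : ℂ) / 15 + k)) =
      Complex.exp (2 * c / 15) ^ (15 * k + b) := by
    rw [← Complex.exp_nat_mul]
    congr 1
    push_cast
    ring
  rw [he, he]
  have hm (j : ℕ) : (15 * k + j + 1) % 15 = (j + 1) % 15 := by lia
  simp only [hm]
  interval_cases a <;> simp [Finset.prod_range_succ, add_assoc]

theorem thetaMoment_div_fifteen {c : ℂ} (hc : c.re < 0) {a b : ℕ} (hab : a + b = 15) :
    thetaMoment 0 (a / 15) c = -Complex.exp (c * (15 / 2 - a) ^ 2 / 225) *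
      (expProd 1 c * (expProd (a / 15) c * expProd (b / 15) c)) := by
  have h := thetaMoment_neg 0 (-(a / 15)) c
  have hb : (b : ℂ) = 15 - a := by
    rw [eq_sub_iff_add_eq']
    exact_mod_cast hab
  rw [neg_neg, thetaMoment_zero_eq_prod hc (-(a / 15)), neg_neg] at h
  rw [h, hb, show c * (1 / 2 + -(a / 15 : ℂ)) ^ 2 = c * (15 / 2 - a) ^ 2 / 225 by ring,
    show -(a / 15 : ℂ) + 1 = (15 - a) / 15 by ring]
  ring

theorem newform15_eq {c τ : ℂ} (hcτ : c = 15 * π * Complex.I * τ) (hc : c.re < 0) :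
    newform15 τ = Complex.exp (2 * c / 15) * (expProd 1 (c / 15) * expProd 1 (c / 5) *
      expProd 1 (c / 3) * expProd 1 c) := by
  have hre (N : ℕ) (hN : 0 < N) : (c / N).re < 0 := by
    rw [Complex.div_natCast_re]
    exact div_neg_of_neg_of_pos hc (by exact_mod_cast hN)
  have h15 := multipliable_expProd 1 (hre 15 (by norm_num))
  have h5 := multipliable_expProd 1 (hre 5 (by norm_num))
  have h3 := multipliable_expProd 1 (hre 3 (by norm_num))
  have h1 := multipliable_expProd 1 hc
  push_cast at h15 h5 h3
  unfold newform15 expProd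
  rw [← h15.tprod_mul h5, ← (h15.mul h5).tprod_mul h3, ← ((h15.mul h5).mul h3).tprod_mul h1,
    show 2 * (π : ℂ) * Complex.I * τ = 2 * c / 15 by rw [hcτ]; ring]
  congr 1
  refine tprod_congr fun n => ?_
  simp only [← Complex.exp_nat_mul]
  push_cast
  congr 1
  · congr 1
    · congr 1 <;> ring_nf
    · ring_nf
  · ring_nf

theorem newform15_mul_sq {c τ : ℂ} (hcτ : c = 15 * π * Complex.I * τ) (hc : c.re < 0) :
    newform15 τ * thetaMoment 1 0 c ^ 2 = thetaMoment 0 (1 / 15) c * thetaMoment 0 (2 / 15) c *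
      thetaMoment 0 (3 / 15) c ^ 2 * thetaMoment 0 (4 / 15) c * thetaMoment 0 (5 / 15) c ^ 2 *
      thetaMoment 0 (6 / 15) c ^ 2 * thetaMoment 0 (7 / 15) c := by
  have t1 := thetaMoment_div_fifteen hc (show 1 + 14 = 15 by norm_num)
  have t2 := thetaMoment_div_fifteen hc (show 2 + 13 = 15 by norm_num)
  have t3 := thetaMoment_div_fifteen hc (show 3 + 12 = 15 by norm_num)
  have t4 := thetaMoment_div_fifteen hc (show 4 + 11 = 15 by norm_num)
  have t5 := thetaMoment_div_fifteen hc (show 5 + 10 = 15 by norm_num)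
  have t6 := thetaMoment_div_fifteen hc (show 6 + 9 = 15 by norm_num)
  have t7 := thetaMoment_div_fifteen hc (show 7 + 8 = 15 by norm_num)
  have s15 := expProd_split hc (N := 15) (by norm_num) (1 / 15)
  have s5 := expProd_split hc (N := 5) (by norm_num) (1 / 5)
  have s3 := expProd_split hc (N := 3) (by norm_num) (1 / 3)
  simp only [Finset.prod_range_succ, Finset.prod_range_zero] at s15 s5 s3
  norm_num at t1 t2 t3 t4 t5 t6 t7 s15 s5 s3 ⊢
  rw [newform15_eq hcτ hc, t1, t2, t3, t4, t5, t6, t7, s15, s5, s3, thetaMoment_one_zero_eq_prod hc]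
  have he : Complex.exp (2 * c / 15) * Complex.exp (c / 4) ^ 2 =
      Complex.exp (c * (169 / 4) / 225) * Complex.exp (c * (121 / 4) / 225) *
      Complex.exp (c * (81 / 4) / 225) ^ 2 * Complex.exp (c * (49 / 4) / 225) *
      Complex.exp (c * (25 / 4) / 225) ^ 2 * Complex.exp (c * (9 / 4) / 225) ^ 2 *
      Complex.exp (c * (1 / 4) / 225) := by
    simp only [← Complex.exp_nat_mul, ← Complex.exp_add]
    congr 1
    push_cast
    ring
  generalize Complex.exp (2 * c / 15) = x0 at he ⊢
  generalize Complex.exp (c / 4) = x1 at he ⊢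
  generalize Complex.exp (c * (169 / 4) / 225) = x2 at he ⊢
  generalize Complex.exp (c * (121 / 4) / 225) = x3 at he ⊢
  generalize Complex.exp (c * (81 / 4) / 225) = x4 at he ⊢
  generalize Complex.exp (c * (49 / 4) / 225) = x5 at he ⊢
  generalize Complex.exp (c * (25 / 4) / 225) = x6 at he ⊢
  generalize Complex.exp (c * (9 / 4) / 225) = x7 at he ⊢
  generalize Complex.exp (c * (1 / 4) / 225) = x8 at he ⊢
  linear_combination (expProd (1 / 15) c * expProd (2 / 15) c * expProd (1 / 5) c ^ 2 *
    expProd (4 / 15) c * expProd (1 / 3) c ^ 2 * expProd (2 / 5) c ^ 2 * expProd (7 / 15) c *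
    expProd (8 / 15) c * expProd (3 / 5) c ^ 2 * expProd (2 / 3) c ^ 2 * expProd (11 / 15) c *
    expProd (4 / 5) c ^ 2 * expProd (13 / 15) c * expProd (14 / 15) c * expProd 1 c ^ 10) * he

/-- The function-field form of the identity, on the curve `x + 1/x = y + 1/y + 1`. -/
theorem curve_identity {x y n₁ n₂ n₄ n₈ r₁ r₂ : ℂ}
    (hC : x ^ 2 * y - x * y ^ 2 - x * y - x + y = 0)
    (h₁ : n₁ = 10 * y ^ 3 * (x ^ 3 * (1 + y)) + 3 * y ^ 2 * (x - 1) * x +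
      (x * y - 1) ^ 3 * (1 + y))
    (hr₁ : r₁ = 30 * (1 + x * y ^ 2) * (x * y - 1) * x * (1 + y))
    (hr₂ : r₂ = 30 * (1 + x * y ^ 2) * (x - 1) * (x * y - 1))
    (h₂ : n₂ = (30 * (1 + x * y ^ 2) * (x * y - 1) * (x - 1) * (1 + y) + 2 * r₁ + r₂) / 5 - n₁)
    (h₄ : n₄ = 2 * n₁ + n₂ - r₁) (h₈ : n₈ = 2 * n₂ + n₄ - r₂) :
    3 * (n₁ ^ 2 - 2 * n₁ * n₂ - 3 * n₂ ^ 2 + 6 * n₂ * n₄ - n₄ ^ 2 + 2 * n₄ * n₈ + 3 * n₈ ^ 2 -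
        6 * n₈ * n₁) * (1 + x * y ^ 2) ^ 2 * (x * y ^ 2 * (x - 1)) * ((1 + y) * (x * y - 1) ^ 3) =
      900 * (1 + y) ^ 2 * y ^ 2 * (x * y - 1) ^ 5 * (x - 1) ^ 2 * (x + y) *
        ((x * y ^ 2 * (x - 1)) ^ 2 -
          11 * (x * y ^ 2 * (x - 1)) * ((1 + y) * (x * y - 1) ^ 3) -
          ((1 + y) * (x * y - 1) ^ 3) ^ 2) := by
  subst h₈ h₄ h₂ h₁ hr₁ hr₂
  linear_combination
    (900 * x ^ 12 * y ^ 16 + 540 * x ^ 11 * y ^ 16 + 3600 * x ^ 12 * y ^ 15 -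
      5220 * x ^ 10 * y ^ 16 - 6840 * x ^ 11 * y ^ 15 + 5400 * x ^ 12 * y ^ 14 +
      3780 * x ^ 9 * y ^ 16 - 16560 * x ^ 10 * y ^ 15 - 25380 * x ^ 11 * y ^ 14 +
      3600 * x ^ 12 * y ^ 13 + 34920 * x ^ 9 * y ^ 15 + 10260 * x ^ 10 * y ^ 14 -
      26100 * x ^ 11 * y ^ 13 + 900 * x ^ 12 * y ^ 12 - 15120 * x ^ 8 * y ^ 15 +
      62460 * x ^ 9 * y ^ 14 + 55440 * x ^ 10 * y ^ 13 - 7200 * x ^ 11 * y ^ 12 -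
      75420 * x ^ 8 * y ^ 14 - 32040 * x ^ 9 * y ^ 13 + 5940 * x ^ 10 * y ^ 12 +
      900 * x ^ 11 * y ^ 11 + 22680 * x ^ 7 * y ^ 14 - 30960 * x ^ 8 * y ^ 13 -
      63720 * x ^ 9 * y ^ 12 - 57600 * x ^ 10 * y ^ 11 + 45180 * x ^ 7 * y ^ 13 +
      220680 * x ^ 8 * y ^ 12 + 173340 * x ^ 9 * y ^ 11 - 29700 * x ^ 10 * y ^ 10 -
      15120 * x ^ 6 * y ^ 13 - 235260 * x ^ 7 * y ^ 12 + 82080 * x ^ 8 * y ^ 11 +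
      277200 * x ^ 9 * y ^ 10 + 74880 * x ^ 6 * y ^ 12 - 622620 * x ^ 7 * y ^ 11 -
      511740 * x ^ 8 * y ^ 10 + 103500 * x ^ 9 * y ^ 9 + 3780 * x ^ 5 * y ^ 12 +
      601200 * x ^ 6 * y ^ 11 - 93780 * x ^ 7 * y ^ 10 - 587520 * x ^ 8 * y ^ 9 -
      177300 * x ^ 5 * y ^ 11 + 923760 * x ^ 6 * y ^ 10 + 847260 * x ^ 7 * y ^ 9 -
      185040 * x ^ 8 * y ^ 8 - 744300 * x ^ 5 * y ^ 10 + 25920 * x ^ 6 * y ^ 9 +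
      782100 * x ^ 7 * y ^ 8 + 178560 * x ^ 4 * y ^ 10 - 864540 * x ^ 5 * y ^ 9 -
      930240 * x ^ 6 * y ^ 8 + 198900 * x ^ 7 * y ^ 7 + 578880 * x ^ 4 * y ^ 9 +
      32220 * x ^ 5 * y ^ 8 - 666000 * x ^ 6 * y ^ 7 - 7020 * x ^ 7 * y ^ 6 -
      103500 * x ^ 3 * y ^ 9 + 548460 * x ^ 4 * y ^ 8 + 635580 * x ^ 5 * y ^ 7 -
      94320 * x ^ 6 * y ^ 6 - 277200 * x ^ 3 * y ^ 8 - 25920 * x ^ 4 * y ^ 7 +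
      290340 * x ^ 5 * y ^ 6 + 28080 * x ^ 6 * y ^ 5 + 29700 * x ^ 2 * y ^ 8 -
      199260 * x ^ 3 * y ^ 7 - 240120 * x ^ 4 * y ^ 6 - 53820 * x ^ 5 * y ^ 5 +
      57600 * x ^ 2 * y ^ 7 + 44280 * x ^ 3 * y ^ 6 + 5040 * x ^ 4 * y ^ 5 - 42120 * x ^ 5 * y ^ 4 -
      900 * x * y ^ 7 + 540 * x ^ 2 * y ^ 6 + 57960 * x ^ 3 * y ^ 5 + 99180 * x ^ 4 * y ^ 4 +
      7200 * x * y ^ 6 - 59760 * x ^ 2 * y ^ 5 - 52740 * x ^ 3 * y ^ 4 + 28080 * x ^ 4 * y ^ 3 -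
      900 * y ^ 6 + 26100 * x * y ^ 5 - 27540 * x ^ 2 * y ^ 4 - 47880 * x ^ 3 * y ^ 3 -
      3600 * y ^ 5 + 28620 * x * y ^ 4 + 12240 * x ^ 2 * y ^ 3 - 7020 * x ^ 3 * y ^ 2 -
      5400 * y ^ 4 + 11160 * x * y ^ 3 + 7380 * x ^ 2 * y ^ 2 - 3600 * y ^ 3 + 540 * x * y ^ 2 -
      900 * y ^ 2) * hC

theorem log_deriv_identity_normalized {x y t ε ζ η s w₁ w₂ w₃ w₄ w₆ w₈ f : ℂ}
    (hx : x ≠ 0) (hy : y ≠ 0) (ht : t ≠ 0) (hε : ε ≠ 0) (hζ : ζ ≠ 0) (hs : s ≠ 0)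
    (hi : ζ * t * (x * y - 1) = x * ε) (hii : ε * (x - y) = y * t * ζ)
    (hiv : ε ^ 2 * ζ = t ^ 2 * (1 + x * y ^ 2))
    (h₃ : (3 * w₃ + w₆) * ε ^ 3 = s * ζ ^ 2) (h₆ : (3 * w₆ - w₃) * ζ ^ 3 = -(s * ε ^ 2))
    (h₁ : (3 * w₁ - w₃) * ε = s * (y * t) ^ 3)
    (hR₁ : (2 * w₁ + w₂ - w₄) * x = s * ε ^ 2)
    (hR₂ : (2 * w₂ + w₄ - w₈) * (y ^ 2 * t ^ 3) = s * ζ ^ 2)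
    (hR₄ : (2 * w₄ + w₈ - w₁) * x ^ 2 = -(s * ε ^ 2))
    (hR₈ : (2 * w₈ + w₁ - w₂) * (t ^ 3 * y) = s * ζ ^ 2)
    (hP : (w₁ + w₂ + w₄ + w₈) * (x * y * t ^ 2) = s * (ε * η * ζ))
    (hG : (ζ ^ 10 - 11 * ε ^ 5 * ζ ^ 5 - ε ^ 10) * s ^ 4 = ε ^ 11 * ζ ^ 11)
    (hf : f * s ^ 2 = x * y * t ^ 2 * (ε * η * ζ) ^ 2) :
    3 * (w₁ ^ 2 - 2 * w₁ * w₂ - 3 * w₂ ^ 2 + 6 * w₂ * w₄ - w₄ ^ 2 + 2 * w₄ * w₈ + 3 * w₈ ^ 2 -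
      6 * w₈ * w₁) * (x * y) = f * ((x + y) * (x * y - 1)) := by
  have hxy : x * y - 1 ≠ 0 := by
    intro h
    rw [h, mul_zero] at hi
    exact mul_ne_zero hx hε hi.symm
  have hxyy : 1 + x * y ^ 2 ≠ 0 := by
    intro h
    rw [h, mul_zero] at hiv
    exact mul_ne_zero (pow_ne_zero 2 hε) hζ hiv
  have hC : x ^ 2 * y - x * y ^ 2 - x * y - x + y = 0 := by
    have : ε * (x ^ 2 * y - x * y ^ 2 - x * y - x + y) = 0 := by
      linear_combination (x * y - 1) * hii + y * hi
    exact (mul_eq_zero.1 this).resolve_left hε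
  have hT : ε ^ 2 * (x - 1) * y ^ 2 * t ^ 3 = ζ ^ 2 * (1 + y) * x ^ 2 := by
    apply mul_left_cancel₀ hs
    linear_combination (-x * y ^ 2 * t ^ 3) * hR₁ - y ^ 2 * t ^ 3 * hR₄ + x ^ 2 * hR₂ +
      x ^ 2 * y * hR₈
  have hy1 : 1 + y ≠ 0 := by
    intro h
    have hx1 : x - 1 = 0 := by
      rw [h, mul_zero, zero_mul] at hT
      simpa [hε, hy, ht] using hT
    have e1 : y = -1 := by linear_combination h
    have e2 : x = 1 := by linear_combination hx1
    rw [e1, e2] at hC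
    norm_num at hC
  have hx1 : x - 1 ≠ 0 := by
    intro h
    rw [h, mul_zero, zero_mul, zero_mul] at hT
    exact mul_ne_zero (mul_ne_zero (pow_ne_zero 2 hζ) hy1) (pow_ne_zero 2 hx) hT.symm
  obtain ⟨σ, hσ⟩ : ∃ σ, σ * ε = s * t ^ 3 := ⟨s * t ^ 3 / ε, div_mul_cancel₀ _ hε⟩
  have hσ0 : σ ≠ 0 := by
    rintro rfl
    rw [zero_mul] at hσ
    exact mul_ne_zero hs (pow_ne_zero 3 ht) hσ.symm
  have hA3 : (3 * w₃ + w₆) * (x ^ 2 * (1 + y)) = σ * (y ^ 2 * (x - 1)) := by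
    apply mul_left_cancel₀ (pow_ne_zero 3 hε)
    linear_combination x ^ 2 * (1 + y) * h₃ - s * hT - ε ^ 2 * y ^ 2 * (x - 1) * hσ
  have hA6 : (3 * w₆ - w₃) * x ^ 3 = -(σ * (x * y - 1) ^ 3) := by
    have hi3 : ζ ^ 3 * t ^ 3 * (x * y - 1) ^ 3 = x ^ 3 * ε ^ 3 := by
      rw [← mul_pow, ← mul_pow, hi, mul_pow]
    apply mul_left_cancel₀ (mul_ne_zero hε (pow_ne_zero 3 hζ))
    linear_combination ε * x ^ 3 * h₆ + s * hi3 + (x * y - 1) ^ 3 * ζ ^ 3 * hσ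
  have hA1 : 3 * w₁ - w₃ = σ * y ^ 3 := by
    apply mul_left_cancel₀ hε
    linear_combination h₁ - y ^ 3 * hσ
  have hεt : ε ^ 3 * x = t ^ 3 * (1 + x * y ^ 2) * (x * y - 1) := by
    linear_combination t * (x * y - 1) * hiv - ε ^ 2 * hi
  have hB1 : (2 * w₁ + w₂ - w₄) * x ^ 2 = σ * (1 + x * y ^ 2) * (x * y - 1) := by
    apply mul_left_cancel₀ hε
    linear_combination ε * x * hR₁ + s * hεt - (1 + x * y ^ 2) * (x * y - 1) * hσ
  have hB2 : (2 * w₂ + w₄ - w₈) * (x ^ 3 * (1 + y)) =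
      σ * (1 + x * y ^ 2) * (x - 1) * (x * y - 1) := by
    apply mul_left_cancel₀ (mul_ne_zero hε (mul_ne_zero (pow_ne_zero 2 hy) (pow_ne_zero 3 ht)))
    linear_combination ε * x ^ 3 * (1 + y) * hR₂ - s * ε * x * hT +
      y ^ 2 * t ^ 3 * (x - 1) * s * hεt -
      y ^ 2 * t ^ 3 * (x - 1) * (1 + x * y ^ 2) * (x * y - 1) * hσ
  have hB0 : (w₁ + w₂ + w₄ + w₈) * x ^ 3 = σ * (1 + x * y ^ 2) * (x * y - 1) * (x - 1) := by
    apply mul_left_cancel₀ hε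
    linear_combination ε * x ^ 2 * hR₁ + ε * x * hR₄ + (x - 1) * s * hεt -
      (x - 1) * (1 + x * y ^ 2) * (x * y - 1) * hσ
  obtain ⟨n₁, e₁⟩ : ∃ n₁, n₁ = 10 * y ^ 3 * (x ^ 3 * (1 + y)) + 3 * y ^ 2 * (x - 1) * x +
      (x * y - 1) ^ 3 * (1 + y) := ⟨_, rfl⟩
  obtain ⟨r₁, er₁⟩ : ∃ r₁, r₁ = 30 * (1 + x * y ^ 2) * (x * y - 1) * x * (1 + y) := ⟨_, rfl⟩
  obtain ⟨r₂, er₂⟩ : ∃ r₂, r₂ = 30 * (1 + x * y ^ 2) * (x - 1) * (x * y - 1) := ⟨_, rfl⟩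
  obtain ⟨n₂, e₂⟩ : ∃ n₂, n₂ = (30 * (1 + x * y ^ 2) * (x * y - 1) * (x - 1) * (1 + y) +
    2 * r₁ + r₂) / 5 - n₁ := ⟨_, rfl⟩
  obtain ⟨n₄, e₄⟩ : ∃ n₄, n₄ = 2 * n₁ + n₂ - r₁ := ⟨_, rfl⟩
  obtain ⟨n₈, e₈⟩ : ∃ n₈, n₈ = 2 * n₂ + n₄ - r₂ := ⟨_, rfl⟩
  have key := curve_identity hC e₁ er₁ er₂ e₂ e₄ e₈
  have hD : 30 * (x ^ 3 * (1 + y)) ≠ 0 :=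
    mul_ne_zero (by norm_num) (mul_ne_zero (pow_ne_zero 3 hx) hy1)
  have hw₁ : w₁ * (30 * (x ^ 3 * (1 + y))) = σ * n₁ := by
    linear_combination 10 * (x ^ 3 * (1 + y)) * hA1 + 3 * x * hA3 - (1 + y) * hA6 - σ * e₁
  have hr₁ : (2 * w₁ + w₂ - w₄) * (30 * (x ^ 3 * (1 + y))) = σ * r₁ := by
    linear_combination 30 * x * (1 + y) * hB1 - σ * er₁
  have hr₂ : (2 * w₂ + w₄ - w₈) * (30 * (x ^ 3 * (1 + y))) = σ * r₂ := by
    linear_combination 30 * hB2 - σ * er₂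
  have hw₂ : w₂ * (30 * (x ^ 3 * (1 + y))) = σ * n₂ := by
    linear_combination 6 * (1 + y) * hB0 + 2 / 5 * hr₁ + 1 / 5 * hr₂ - hw₁ - σ * e₂
  have hw₄ : w₄ * (30 * (x ^ 3 * (1 + y))) = σ * n₄ := by
    linear_combination 2 * hw₁ + hw₂ - hr₁ - σ * e₄
  have hw₈ : w₈ * (30 * (x ^ 3 * (1 + y))) = σ * n₈ := by
    linear_combination 2 * hw₂ + hw₄ - hr₂ - σ * e₈
  clear e₁ er₁ er₂ e₂ e₄ e₈ hr₁ hr₂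
  have hi3 : ζ ^ 3 * t ^ 3 * (x * y - 1) ^ 3 = x ^ 3 * ε ^ 3 := by
    rw [← mul_pow, ← mul_pow, hi, mul_pow]
  have hAB : ζ ^ 5 * ((1 + y) * (x * y - 1) ^ 3) = ε ^ 5 * (x * y ^ 2 * (x - 1)) := by
    apply mul_left_cancel₀ (mul_ne_zero (pow_ne_zero 2 hx) (pow_ne_zero 3 ht))
    linear_combination x ^ 2 * ζ ^ 2 * (1 + y) * hi3 - x ^ 3 * ε ^ 3 * hT
  have hA0 : x * y ^ 2 * (x - 1) ≠ 0 := mul_ne_zero (mul_ne_zero hx (pow_ne_zero 2 hy)) hx1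
  have hB0' : (1 + y) * (x * y - 1) ^ 3 ≠ 0 := mul_ne_zero hy1 (pow_ne_zero 3 hxy)
  obtain ⟨A, hA⟩ : ∃ A, A = x * y ^ 2 * (x - 1) := ⟨_, rfl⟩
  obtain ⟨B, hB⟩ : ∃ B, B = (1 + y) * (x * y - 1) ^ 3 := ⟨_, rfl⟩
  rw [← hA, ← hB] at key hAB
  rw [← hA] at hA0
  rw [← hB] at hB0'
  have hS : s ^ 4 * (A ^ 2 - 11 * A * B - B ^ 2) = A * B * (ε ^ 6 * ζ ^ 6) := by
    apply mul_left_cancel₀ (pow_ne_zero 10 hε)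
    linear_combination B ^ 2 * hG + (11 * s ^ 4 * ε ^ 5 * B + ε ^ 11 * ζ ^ 6 * B -
      s ^ 4 * (ζ ^ 5 * B + ε ^ 5 * A)) * hAB
  have hεζ : ε ^ 6 * ζ ^ 6 * (x * y - 1) ^ 2 = t ^ 6 * x ^ 2 * (1 + x * y ^ 2) ^ 4 := by
    have h4 : (ε ^ 2 * ζ) ^ 4 = (t ^ 2 * (1 + x * y ^ 2)) ^ 4 := by rw [hiv]
    have h2 : (ζ * t * (x * y - 1)) ^ 2 = (x * ε) ^ 2 := by rw [hi]
    apply mul_left_cancel₀ (pow_ne_zero 2 ht)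
    linear_combination ε ^ 6 * ζ ^ 4 * h2 + x ^ 2 * h4
  have hG0 : A ^ 2 - 11 * A * B - B ^ 2 ≠ 0 := by
    intro h
    rw [h, mul_zero] at hS
    exact mul_ne_zero (mul_ne_zero hA0 hB0') (mul_ne_zero (pow_ne_zero 6 hε) (pow_ne_zero 6 hζ))
      hS.symm
  have hfs : f * s ^ 4 * x ^ 3 = y ^ 3 * t ^ 6 * (σ * (1 + x * y ^ 2) * (x * y - 1) * (x - 1)) ^ 2 := by
    have hP2 : ((w₁ + w₂ + w₄ + w₈) * (x * y * t ^ 2)) ^ 2 = (s * (ε * η * ζ)) ^ 2 := by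
      rw [hP]
    rw [← hB0]
    linear_combination x ^ 3 * s ^ 2 * hf - x ^ 4 * y * t ^ 2 * hP2
  apply mul_left_cancel₀ (mul_ne_zero (mul_ne_zero (pow_ne_zero 4 hs) hG0) (mul_ne_zero
    (pow_ne_zero 2 hD) (mul_ne_zero (pow_ne_zero 2 hxy) (pow_ne_zero 3 hx))))
  obtain ⟨Q, hQ⟩ : ∃ Q, Q = w₁ ^ 2 - 2 * w₁ * w₂ - 3 * w₂ ^ 2 + 6 * w₂ * w₄ - w₄ ^ 2 +
    2 * w₄ * w₈ + 3 * w₈ ^ 2 - 6 * w₈ * w₁ := ⟨_, rfl⟩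
  obtain ⟨N, hN⟩ : ∃ N, N = n₁ ^ 2 - 2 * n₁ * n₂ - 3 * n₂ ^ 2 + 6 * n₂ * n₄ - n₄ ^ 2 +
    2 * n₄ * n₈ + 3 * n₈ ^ 2 - 6 * n₈ * n₁ := ⟨_, rfl⟩
  have hQN : Q * (30 * (x ^ 3 * (1 + y))) ^ 2 = σ ^ 2 * N := by
    calc Q * (30 * (x ^ 3 * (1 + y))) ^ 2 =
        (w₁ * (30 * (x ^ 3 * (1 + y)))) ^ 2 - 2 * (w₁ * (30 * (x ^ 3 * (1 + y)))) *
          (w₂ * (30 * (x ^ 3 * (1 + y)))) - 3 * (w₂ * (30 * (x ^ 3 * (1 + y)))) ^ 2 +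
          6 * (w₂ * (30 * (x ^ 3 * (1 + y)))) * (w₄ * (30 * (x ^ 3 * (1 + y)))) -
          (w₄ * (30 * (x ^ 3 * (1 + y)))) ^ 2 + 2 * (w₄ * (30 * (x ^ 3 * (1 + y)))) *
          (w₈ * (30 * (x ^ 3 * (1 + y)))) + 3 * (w₈ * (30 * (x ^ 3 * (1 + y)))) ^ 2 -
          6 * (w₈ * (30 * (x ^ 3 * (1 + y)))) * (w₁ * (30 * (x ^ 3 * (1 + y)))) := by
          rw [hQ]; ring
      _ = σ ^ 2 * N := by rw [hw₁, hw₂, hw₄, hw₈, hN]; ring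
  rw [← hQ]
  rw [← hN] at key
  linear_combination 3 * s ^ 4 * (A ^ 2 - 11 * A * B - B ^ 2) * (x * y - 1) ^ 2 * x ^ 4 * y * hQN +
    3 * σ ^ 2 * N * (x * y - 1) ^ 2 * x ^ 4 * y * hS +
    3 * A * B * σ ^ 2 * N * x ^ 4 * y * hεζ + σ ^ 2 * x ^ 6 * y * t ^ 6 * (1 + x * y ^ 2) ^ 2 * key -
    (A ^ 2 - 11 * A * B - B ^ 2) * (30 * (x ^ 3 * (1 + y))) ^ 2 * (x * y - 1) ^ 3 * (x + y) * hfs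

theorem log_deriv_identity {h₁ h₂ h₃ h₄ h₅ h₆ h₇ s w₁ w₂ w₃ w₄ w₆ w₈ f : ℂ}
    (n₁ : h₁ ≠ 0) (n₂ : h₂ ≠ 0) (n₃ : h₃ ≠ 0) (n₄ : h₄ ≠ 0) (n₆ : h₆ ≠ 0) (n₇ : h₇ ≠ 0)
    (hs : s ≠ 0)
    (hi : h₁ * h₃ * h₄ + h₁ * h₆ * h₇ - h₂ * h₄ * h₆ = 0)
    (hii : h₁ * h₂ * h₃ + h₂ * h₆ * h₇ - h₃ * h₄ * h₇ = 0)
    (hiv : h₁ * h₇ ^ 2 + h₂ ^ 2 * h₄ - h₃ ^ 2 * h₆ = 0)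
    (e₃ : (3 * w₃ + w₆) * h₃ ^ 3 = s * h₆ ^ 2) (e₆ : (3 * w₆ - w₃) * h₆ ^ 3 = -(s * h₃ ^ 2))
    (e₁ : (3 * w₁ - w₃) * (h₁ ^ 3 * h₃) = s * h₂ ^ 3)
    (hR₁ : (2 * w₁ + w₂ - w₄) * (h₁ ^ 2 * h₄) = s * h₃ ^ 2)
    (hR₂ : (2 * w₂ + w₄ - w₈) * (h₂ ^ 2 * h₇) = s * h₆ ^ 2)
    (hR₄ : (2 * w₄ + w₈ - w₁) * (h₄ ^ 2 * h₁) = -(s * h₃ ^ 2))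
    (hR₈ : (2 * w₈ + w₁ - w₂) * (h₇ ^ 2 * h₂) = s * h₆ ^ 2)
    (hP : (w₁ + w₂ + w₄ + w₈) * (h₁ * h₂ * h₄ * h₇) = s * (h₃ * h₅ * h₆))
    (hG : (h₆ ^ 10 - 11 * h₃ ^ 5 * h₆ ^ 5 - h₃ ^ 10) * s ^ 4 = h₃ ^ 11 * h₆ ^ 11)
    (hf : f * s ^ 2 = h₁ * h₂ * h₃ ^ 2 * h₄ * h₅ ^ 2 * h₆ ^ 2 * h₇) :
    3 * (w₁ ^ 2 - 2 * w₁ * w₂ - 3 * w₂ ^ 2 + 6 * w₂ * w₄ - w₄ ^ 2 + 2 * w₄ * w₈ + 3 * w₈ ^ 2 -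
      6 * w₈ * w₁) * (h₂ * h₄ / (h₁ * h₇)) =
      f * ((h₄ / h₁ + h₂ / h₇) * (h₄ / h₁ * (h₂ / h₇) - 1)) := by
  have key := log_deriv_identity_normalized (x := h₄ / h₁) (y := h₂ / h₇) (t := h₇ / h₁)
    (ε := h₃ / h₁) (ζ := h₆ / h₁) (η := h₅ / h₁) (s := s / h₁ ^ 3) (w₁ := w₁ / h₁ ^ 2)
    (w₂ := w₂ / h₁ ^ 2) (w₃ := w₃ / h₁ ^ 2) (w₄ := w₄ / h₁ ^ 2) (w₆ := w₆ / h₁ ^ 2)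
    (w₈ := w₈ / h₁ ^ 2) (f := f / h₁ ^ 4) (div_ne_zero n₄ n₁) (div_ne_zero n₂ n₇)
    (div_ne_zero n₇ n₁) (div_ne_zero n₃ n₁) (div_ne_zero n₆ n₁)
    (div_ne_zero hs (pow_ne_zero 3 n₁))
    (by field_simp; linear_combination -hi) (by field_simp; linear_combination -hii)
    (by field_simp; linear_combination -hiv) (by field_simp; linear_combination e₃)
    (by field_simp; linear_combination e₆) (by field_simp; linear_combination e₁)
    (by field_simp; linear_combination hR₁) (by field_simp; linear_combination hR₂)
    (by field_simp; linear_combination hR₄) (by field_simp; linear_combination hR₈)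
    (by field_simp; linear_combination hP) (by field_simp; linear_combination hG)
    (by field_simp; linear_combination hf)
  field_simp at key ⊢
  linear_combination key

/-- The value of `thetaMoment` at the `15`-division point `a / 15`. -/
noncomputable def divValue (j : ℕ) (a : ℤ) (c : ℂ) : ℂ := thetaMoment j (a / 15) c

theorem thetaMoment_div (j : ℕ) (a : ℤ) (c : ℂ) : thetaMoment j (a / 15) c = divValue j a c := rfl

theorem divValue_neg (j : ℕ) (a : ℤ) (c : ℂ) :
    divValue j (-a) c = (-1) ^ (j + 1) * divValue j a c := by
  unfold divValue
  rw [← thetaMoment_neg]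
  congr 1
  push_cast
  ring

theorem divValue_add (j : ℕ) (a : ℤ) (c : ℂ) : divValue j (a + 15) c = -divValue j a c := by
  unfold divValue
  rw [← thetaMoment_add_one]
  congr 1
  push_cast
  ring

theorem divValue_sub (j : ℕ) (a : ℤ) (c : ℂ) :
    divValue j (15 - a) c = (-1) ^ j * divValue j a c := by
  rw [sub_eq_neg_add, divValue_add, divValue_neg]
  ring

theorem divValue_ne_zero {c : ℂ} (hc : c.re < 0) {a : ℤ} (h0 : 0 < a) (h15 : a < 15) :
    divValue 0 a c ≠ 0 := by
  obtain ⟨n, rfl⟩ := Int.eq_ofNat_of_zero_le h0.le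
  obtain ⟨m, hm⟩ : ∃ m : ℕ, n + m = 15 := ⟨15 - n, by lia⟩
  have hn : (0 : ℝ) < n / 15 := by
    have : (0 : ℝ) < n := by exact_mod_cast h0
    positivity
  have hm' : (0 : ℝ) < m / 15 := by
    have : 0 < m := by lia
    have : (0 : ℝ) < m := by exact_mod_cast this
    positivity
  unfold divValue
  rw [Int.cast_natCast, thetaMoment_div_fifteen hc hm]
  have e1 := expProd_ne_zero hc one_pos
  have e2 := expProd_ne_zero hc hn
  have e3 := expProd_ne_zero hc hm'
  push_cast at e1 e2 e3
  exact mul_ne_zero (neg_ne_zero.2 (Complex.exp_ne_zero _)) (mul_ne_zero e1 (mul_ne_zero e2 e3))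

theorem thetaMoment_one_zero_ne_zero {c : ℂ} (hc : c.re < 0) : thetaMoment 1 0 c ≠ 0 := by
  rw [thetaMoment_one_zero_eq_prod hc]
  have e1 := expProd_ne_zero hc one_pos
  push_cast at e1
  exact mul_ne_zero (Complex.exp_ne_zero _) (pow_ne_zero 3 e1)

/-- The ratio `θ⁽ʲ⁾ / θ` at the `15`-division point `a / 15`. -/
noncomputable def divRatio (j : ℕ) (a : ℤ) (c : ℂ) : ℂ := divValue j a c / divValue 0 a c

theorem divRatio_add (j : ℕ) (a : ℤ) (c : ℂ) : divRatio j (a + 15) c = divRatio j a c := by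
  unfold divRatio
  rw [divValue_add, divValue_add, neg_div_neg_eq]

theorem divRatio_sub (j : ℕ) (a : ℤ) (c : ℂ) :
    divRatio j (15 - a) c = (-1) ^ j * divRatio j a c := by
  unfold divRatio
  rw [divValue_sub, divValue_sub, pow_zero, one_mul, mul_div_assoc]

theorem divRatio_add_add {c : ℂ} (hc : c.re < 0) {a b d : ℤ} (ha : divValue 0 a c ≠ 0)
    (hb : divValue 0 b c ≠ 0) (hd : divValue 0 d c ≠ 0) (he : divValue 0 (a + b + d) c ≠ 0) :
    (divRatio 1 a c + divRatio 1 b c + divRatio 1 d c - divRatio 1 (a + b + d) c) *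
      (divValue 0 a c * divValue 0 b c * divValue 0 d c * divValue 0 (a + b + d) c) =
      thetaMoment 1 0 c * (divValue 0 (a + b) c * divValue 0 (a + d) c * divValue 0 (b + d) c) := by
  have h := thetaMoment_four_term hc (a / 15) (b / 15) (d / 15) (((-(a + b + d) : ℤ) : ℂ) / 15)
    (by push_cast; ring)
  have h0 := divValue_neg 0 (a + b + d) c
  have h1 := divValue_neg 1 (a + b + d) c
  have e1 : (a / 15 + b / 15 : ℂ) = ((a + b : ℤ) : ℂ) / 15 := by push_cast; ring
  have e2 : (a / 15 + d / 15 : ℂ) = ((a + d : ℤ) : ℂ) / 15 := by push_cast; ring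
  have e3 : (b / 15 + d / 15 : ℂ) = ((b + d : ℤ) : ℂ) / 15 := by push_cast; ring
  rw [e1, e2, e3] at h
  simp only [thetaMoment_div] at h
  rw [h0, h1] at h
  unfold divRatio
  field_simp
  linear_combination -h

theorem divRatio_two_mul {c : ℂ} (hc : c.re < 0) {a : ℤ} (ha : divValue 0 a c ≠ 0)
    (hb : divValue 0 (2 * a) c ≠ 0) :
    thetaMoment 3 0 c = thetaMoment 1 0 c * (2 * divRatio 2 a c + divRatio 2 (2 * a) c +
      2 * (divRatio 1 a c ^ 2 - 2 * divRatio 1 a c * divRatio 1 (2 * a) c)) := by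
  have h := thetaMoment_quadratic hc (a / 15) (a / 15) (((-(2 * a) : ℤ) : ℂ) / 15)
    (by push_cast; ring)
  simp only [thetaMoment_div] at h
  rw [divValue_neg, divValue_neg, divValue_neg] at h
  unfold divRatio
  field_simp
  linear_combination -h

theorem divValue_three_term {c : ℂ} (hc : c.re < 0) (a b d e : ℤ) :
    divValue 0 (a + b) c * divValue 0 (a - b) c * (divValue 0 (d + e) c * divValue 0 (d - e) c) -
      divValue 0 (a + d) c * divValue 0 (a - d) c * (divValue 0 (b + e) c * divValue 0 (b - e) c) +
      divValue 0 (a + e) c * divValue 0 (a - e) c * (divValue 0 (b + d) c * divValue 0 (b - d) c) =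
      0 := by
  have h := thetaMoment_three_term hc (a / 15) (b / 15) (d / 15) (e / 15)
  simp only [← add_div, ← sub_div, ← Int.cast_add, ← Int.cast_sub, thetaMoment_div] at h
  exact h

theorem divValue_relations {c : ℂ} (hc : c.re < 0) :
    (divValue 0 1 c * divValue 0 3 c * divValue 0 4 c + divValue 0 1 c * divValue 0 6 c *
      divValue 0 7 c - divValue 0 2 c * divValue 0 4 c * divValue 0 6 c = 0) ∧
    (divValue 0 1 c * divValue 0 2 c * divValue 0 3 c + divValue 0 2 c * divValue 0 6 c *
      divValue 0 7 c - divValue 0 3 c * divValue 0 4 c * divValue 0 7 c = 0) ∧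
    (divValue 0 1 c * divValue 0 7 c ^ 2 + divValue 0 2 c ^ 2 * divValue 0 4 c -
      divValue 0 3 c ^ 2 * divValue 0 6 c = 0) := by
  have h5 := divValue_ne_zero hc (a := 5) (by norm_num) (by norm_num)
  have a₁ := divValue_three_term hc 1 2 3 7
  have a₂ := divValue_three_term hc 1 2 4 6
  have a₃ := divValue_three_term hc 0 2 3 7
  have p8 := divValue_sub 0 7 c
  have p9 := divValue_sub 0 6 c
  have p10 := divValue_sub 0 5 c
  have m1 := divValue_neg 0 1 c
  have m2 := divValue_neg 0 2 c
  have m3 := divValue_neg 0 3 c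
  have m4 := divValue_neg 0 4 c
  have m5 := divValue_neg 0 5 c
  have m6 := divValue_neg 0 6 c
  have m7 := divValue_neg 0 7 c
  norm_num at a₁ a₂ a₃ p8 p9 p10 m1 m2 m3 m4 m5 m6 m7
  simp only [p8, p9, p10, m1, m2, m3, m4, m5, m6, m7] at a₁ a₂ a₃
  refine ⟨mul_left_cancel₀ h5 ?_, mul_left_cancel₀ h5 ?_, mul_left_cancel₀ h5 ?_⟩
  · linear_combination a₁
  · linear_combination a₂
  · linear_combination a₃

theorem divRatio_quintic_relations {c : ℂ} (hc : c.re < 0) :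
    ((3 * divRatio 1 3 c + divRatio 1 6 c) * divValue 0 3 c ^ 3 =
      thetaMoment 1 0 c * divValue 0 6 c ^ 2) ∧
    ((3 * divRatio 1 6 c - divRatio 1 3 c) * divValue 0 6 c ^ 3 =
      -(thetaMoment 1 0 c * divValue 0 3 c ^ 2)) := by
  have h3 := divValue_ne_zero hc (a := 3) (by norm_num) (by norm_num)
  have h6 := divValue_ne_zero hc (a := 6) (by norm_num) (by norm_num)
  have p9 := divValue_sub 0 6 c
  have p12 := divValue_sub 0 3 c
  have p18 := divValue_add 0 3 c
  have q9 := divRatio_sub 1 6 c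
  have q18 := divRatio_add 1 3 c
  norm_num at p9 p12 p18 q9 q18
  have a₃ := divRatio_add_add hc h3 h3 h3 (by norm_num; rwa [p9])
  have a₆ := divRatio_add_add hc h6 h6 h6 (by norm_num; rwa [p18, neg_eq_zero])
  norm_num at a₃ a₆
  simp only [p9, p12, p18, q9, q18] at a₃ a₆
  constructor
  · apply mul_left_cancel₀ h6
    linear_combination a₃
  · apply mul_left_cancel₀ h3
    linear_combination -a₆

theorem divRatio_relations {c : ℂ} (hc : c.re < 0) :
    ((3 * divRatio 1 1 c - divRatio 1 3 c) * (divValue 0 1 c ^ 3 * divValue 0 3 c) =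
      thetaMoment 1 0 c * divValue 0 2 c ^ 3) ∧
    ((2 * divRatio 1 1 c + divRatio 1 2 c - divRatio 1 4 c) *
      (divValue 0 1 c ^ 2 * divValue 0 4 c) = thetaMoment 1 0 c * divValue 0 3 c ^ 2) ∧
    ((2 * divRatio 1 2 c + divRatio 1 4 c - divRatio 1 8 c) *
      (divValue 0 2 c ^ 2 * divValue 0 7 c) = thetaMoment 1 0 c * divValue 0 6 c ^ 2) ∧
    ((2 * divRatio 1 4 c + divRatio 1 8 c - divRatio 1 1 c) *
      (divValue 0 4 c ^ 2 * divValue 0 1 c) = -(thetaMoment 1 0 c * divValue 0 3 c ^ 2)) ∧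
    ((2 * divRatio 1 8 c + divRatio 1 1 c - divRatio 1 2 c) *
      (divValue 0 7 c ^ 2 * divValue 0 2 c) = thetaMoment 1 0 c * divValue 0 6 c ^ 2) ∧
    ((divRatio 1 1 c + divRatio 1 2 c + divRatio 1 4 c + divRatio 1 8 c) *
      (divValue 0 1 c * divValue 0 2 c * divValue 0 4 c * divValue 0 7 c) =
      thetaMoment 1 0 c * (divValue 0 3 c * divValue 0 5 c * divValue 0 6 c)) := by
  have h1 := divValue_ne_zero hc (a := 1) (by norm_num) (by norm_num)
  have h2 := divValue_ne_zero hc (a := 2) (by norm_num) (by norm_num)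
  have h3 := divValue_ne_zero hc (a := 3) (by norm_num) (by norm_num)
  have h4 := divValue_ne_zero hc (a := 4) (by norm_num) (by norm_num)
  have h7 := divValue_ne_zero hc (a := 7) (by norm_num) (by norm_num)
  have h8 := divValue_ne_zero hc (a := 8) (by norm_num) (by norm_num)
  have p8 := divValue_sub 0 7 c
  have p9 := divValue_sub 0 6 c
  have p12 := divValue_sub 0 3 c
  have p16 := divValue_add 0 1 c
  have p17 := divValue_add 0 2 c
  have q7 := divRatio_sub 1 8 c
  have q16 := divRatio_add 1 1 c
  have q17 := divRatio_add 1 2 c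
  norm_num at p8 p9 p12 p16 p17 q7 q16 q17
  have a₁ := divRatio_add_add hc h1 h1 h1 (by norm_num; exact h3)
  have a₂ := divRatio_add_add hc h1 h1 h2 (by norm_num; exact h4)
  have a₃ := divRatio_add_add hc h2 h2 h4 (by norm_num; exact h8)
  have a₄ := divRatio_add_add hc h4 h4 h8 (by norm_num; rwa [p16, neg_eq_zero])
  have a₅ := divRatio_add_add hc h8 h8 h1 (by norm_num; rwa [p17, neg_eq_zero])
  have a₆ := divRatio_add_add hc h1 h2 h4 (by norm_num; exact h7)
  norm_num at a₁ a₂ a₃ a₄ a₅ a₆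
  simp only [p8, p9, p12, p16, p17, q7, q16, q17] at a₁ a₂ a₃ a₄ a₅ a₆
  refine ⟨?_, mul_left_cancel₀ h2 ?_, mul_left_cancel₀ h4 ?_, mul_left_cancel₀ h7 ?_,
    mul_left_cancel₀ h1 ?_, ?_⟩
  · linear_combination a₁
  · linear_combination a₂
  · linear_combination a₃
  · linear_combination -a₄
  · linear_combination -a₅
  · linear_combination a₆

theorem divRatio_two_combination {c : ℂ} (hc : c.re < 0) :
    5 * (divRatio 2 2 c + divRatio 2 4 c - divRatio 2 1 c - divRatio 2 7 c) =
      2 * (divRatio 1 1 c ^ 2 - 2 * divRatio 1 1 c * divRatio 1 2 c - 3 * divRatio 1 2 c ^ 2 +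
        6 * divRatio 1 2 c * divRatio 1 4 c - divRatio 1 4 c ^ 2 +
        2 * divRatio 1 4 c * divRatio 1 8 c + 3 * divRatio 1 8 c ^ 2 -
        6 * divRatio 1 8 c * divRatio 1 1 c) := by
  have h1 := divValue_ne_zero hc (a := 1) (by norm_num) (by norm_num)
  have h2 := divValue_ne_zero hc (a := 2) (by norm_num) (by norm_num)
  have h4 := divValue_ne_zero hc (a := 4) (by norm_num) (by norm_num)
  have h8 := divValue_ne_zero hc (a := 8) (by norm_num) (by norm_num)
  have p16 := divValue_add 0 1 c
  have q16 := divRatio_add 1 1 c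
  have r16 := divRatio_add 2 1 c
  have r8 := divRatio_sub 2 7 c
  norm_num at p16 q16 r16 r8
  have a₁ := divRatio_two_mul hc h1 (by norm_num; exact h2)
  have a₂ := divRatio_two_mul hc h2 (by norm_num; exact h4)
  have a₄ := divRatio_two_mul hc h4 (by norm_num; exact h8)
  have a₈ := divRatio_two_mul hc h8 (by norm_num; rwa [p16, neg_eq_zero])
  norm_num at a₁ a₂ a₄ a₈
  rw [q16, r16] at a₈
  rw [r8] at a₄ a₈
  apply mul_left_cancel₀ (thetaMoment_one_zero_ne_zero hc)
  linear_combination a₁ - 3 * a₂ - a₄ + 3 * a₈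

theorem hasDerivAt_thetaMoment_nome {c : ℂ} (hc : c.re < 0) (j : ℕ) (x : ℂ) :
    HasDerivAt (thetaMoment j x) (thetaMoment (j + 2) x c) c :=
  hasDerivAt_gaussMoment_right norm_neg_one_zpow_le j _ hc

theorem hasDerivAt_divValue {c : ℂ} (hc : c.re < 0) (j : ℕ) (a : ℤ) :
    HasDerivAt (divValue j a) (divValue (j + 2) a c) c :=
  hasDerivAt_thetaMoment_nome hc j _

theorem divValue_two_eq {c : ℂ} {a : ℤ} (h : divValue 0 a c ≠ 0) :
    divValue 2 a c = divRatio 2 a c * divValue 0 a c :=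
  (div_mul_cancel₀ _ h).symm

/-- The weight zero quotient which expresses `X - 11 - 1 / X` in terms of theta constants. -/
noncomputable def quinticQuot (c : ℂ) : ℂ :=
  (divValue 0 6 c ^ 10 - 11 * (divValue 0 3 c ^ 5 * divValue 0 6 c ^ 5) - divValue 0 3 c ^ 10) *
    thetaMoment 1 0 c ^ 4 / (divValue 0 3 c ^ 11 * divValue 0 6 c ^ 11)

theorem hasDerivAt_quinticQuot {c : ℂ} (hc : c.re < 0) : HasDerivAt quinticQuot 0 c := by
  have h3 := divValue_ne_zero hc (a := 3) (by norm_num) (by norm_num)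
  have h6 := divValue_ne_zero hc (a := 6) (by norm_num) (by norm_num)
  have hs := thetaMoment_one_zero_ne_zero hc
  have d3 := hasDerivAt_divValue hc 0 3
  have d6 := hasDerivAt_divValue hc 0 6
  have ds := hasDerivAt_thetaMoment_nome hc 1 0
  have d := ((((d6.pow 10).sub (((d3.pow 5).mul (d6.pow 5)).const_mul 11)).sub (d3.pow 10)).mul
    (ds.pow 4)).div ((d3.pow 11).mul (d6.pow 11))
    (mul_ne_zero (pow_ne_zero 11 h3) (pow_ne_zero 11 h6))
  refine d.congr_deriv (div_eq_zero_iff.2 (Or.inl ?_))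
  obtain ⟨e3, e6⟩ := divRatio_quintic_relations hc
  have p12 := divValue_sub 0 3 c
  have q12 := divRatio_sub 1 3 c
  have r12 := divRatio_sub 2 3 c
  norm_num at p12 q12 r12
  have k3 := divRatio_two_mul hc h3 (by norm_num; exact h6)
  have k6 := divRatio_two_mul hc h6 (by norm_num; rwa [p12])
  norm_num at k3 k6
  rw [q12, r12] at k6
  simp only [Pi.pow_apply, Pi.mul_apply, Pi.sub_apply, zero_add, Nat.reduceAdd,
    divValue_two_eq h3, divValue_two_eq h6]
  push_cast
  generalize divValue 0 3 c = v at *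
  generalize divValue 0 6 c = u at *
  generalize thetaMoment 1 0 c = s at *
  generalize thetaMoment 3 0 c = r at *
  generalize divRatio 1 3 c = w₃ at *
  generalize divRatio 1 6 c = w₆ at *
  generalize divRatio 2 3 c = q₃ at *
  generalize divRatio 2 6 c = q₆ at *
  obtain ⟨ρ, rfl⟩ : ∃ ρ, r = s * ρ := ⟨r / s, (mul_div_cancel₀ r hs).symm⟩
  have k3' := mul_left_cancel₀ hs k3
  have k6' := mul_left_cancel₀ hs k6
  have g3 : q₃ = (ρ - 4 * w₃ ^ 2 + 2 * w₆ ^ 2 + 12 * w₃ * w₆) / 3 := by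
    linear_combination -2 / 3 * k3' + 1 / 3 * k6'
  have g6 : q₆ = (ρ - 4 * w₆ ^ 2 + 2 * w₃ ^ 2 - 12 * w₃ * w₆) / 3 := by
    linear_combination -2 / 3 * k6' + 1 / 3 * k3'
  have hαβ : (3 * w₃ + w₆) * v ^ 5 + (3 * w₆ - w₃) * u ^ 5 = 0 := by
    linear_combination v ^ 2 * e3 + u ^ 2 * e6
  rw [g3, g6]
  linear_combination (s ^ 4 * (v ^ 11 * u ^ 11) / 15 * (12 * ((3 * w₆ - w₃) * u ^ 5 -
    (3 * w₃ + w₆) * v ^ 5) - 66 * (3 * w₃ + w₆) * u ^ 5 - 66 * (3 * w₆ - w₃) * v ^ 5)) * hαβ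

theorem tendsto_quinticQuot : Tendsto quinticQuot (comap Complex.re atBot) (𝓝 1) := by
  have hl : Tendsto Complex.re (comap Complex.re atBot) atBot := tendsto_comap
  have t1 := tendsto_expProd_one one_pos hl
  have t3 := tendsto_expProd_one (a := 3 / 15) (by norm_num) hl
  have t12 := tendsto_expProd_one (a := 12 / 15) (by norm_num) hl
  have t6 := tendsto_expProd_one (a := 6 / 15) (by norm_num) hl
  have t9 := tendsto_expProd_one (a := 9 / 15) (by norm_num) hl
  push_cast at t1 t3 t12 t6 t9
  have te : Tendsto (fun c : ℂ => Complex.exp (2 * c / 5)) (comap Complex.re atBot) (𝓝 0) := by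
    apply Complex.tendsto_exp_comap_re_atBot.comp
    rw [tendsto_comap_iff]
    have : (Complex.re ∘ fun c : ℂ => 2 * c / 5) = fun c => (2 / 5 : ℝ) * c.re := by
      funext c
      simp
      ring
    rw [this]
    exact hl.const_mul_atBot (by norm_num)
  have s3 := t1.mul (t3.mul t12)
  have s6 := t1.mul (t6.mul t9)
  have key := (((s6.pow 10).sub ((te.mul ((s3.pow 5).mul (s6.pow 5))).const_mul 11)).sub
    ((te.pow 2).mul (s3.pow 10))).mul (t1.pow 12) |>.div ((s3.pow 11).mul (s6.pow 11))
    (by norm_num)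
  norm_num at key
  refine key.congr' ?_
  filter_upwards [hl.eventually (eventually_lt_atBot 0)] with c hc
  have e3 := thetaMoment_div_fifteen hc (show 3 + 12 = 15 by norm_num)
  have e6 := thetaMoment_div_fifteen hc (show 6 + 9 = 15 by norm_num)
  have hx : ∃ x : ℂ, x ≠ 0 ∧ Complex.exp (c * (15 / 2 - (6 : ℕ)) ^ 2 / 225) = x ∧
      Complex.exp (c * (15 / 2 - (3 : ℕ)) ^ 2 / 225) = x ^ 9 ∧ Complex.exp (c / 4) = x ^ 25 ∧
      Complex.exp (2 * c / 5) = x ^ 40 := by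
    refine ⟨Complex.exp (c / 100), Complex.exp_ne_zero _, ?_, ?_, ?_, ?_⟩ <;>
    (try rw [← Complex.exp_nat_mul]) <;> congr 1 <;> push_cast <;> ring
  obtain ⟨x, hx0, x6, x3, xs, xe⟩ := hx
  have n1 := expProd_ne_zero hc one_pos
  have n3 := expProd_ne_zero hc (a := 3 / 15) (by norm_num)
  have n12 := expProd_ne_zero hc (a := 12 / 15) (by norm_num)
  have n6 := expProd_ne_zero hc (a := 6 / 15) (by norm_num)
  have n9 := expProd_ne_zero hc (a := 9 / 15) (by norm_num)
  rw [x6] at e6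
  rw [x3] at e3
  unfold quinticQuot divValue
  rw [thetaMoment_one_zero_eq_prod hc, xs]
  simp only [Pi.div_apply]
  rw [xe]
  norm_num at e3 e6 n1 n3 n12 n6 n9 ⊢
  rw [e3, e6]
  field_simp

theorem quinticQuot_eq_one {c : ℂ} (hc : c.re < 0) : quinticQuot c = 1 := by
  have hopen : IsOpen {z : ℂ | z.re < 0} := isOpen_lt Complex.continuous_re continuous_const
  have hconn : IsPreconnected {z : ℂ | z.re < 0} := (convex_halfSpace_re_lt 0).isPreconnected
  have hconst : ∀ z : ℂ, z.re < 0 → quinticQuot z = quinticQuot c := fun z hz =>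
    hopen.is_const_of_deriv_eq_zero hconn
      (fun w hw => (hasDerivAt_quinticQuot hw).differentiableAt.differentiableWithinAt)
      (fun w hw => (hasDerivAt_quinticQuot hw).deriv) hz hc
  have hne : (comap Complex.re atBot).NeBot :=
    (inferInstance : (atBot : Filter ℝ).NeBot).comap_of_surj fun r => ⟨r, Complex.ofReal_re r⟩
  refine tendsto_nhds_unique (tendsto_const_nhds.congr' ?_) tendsto_quinticQuot
  filter_upwards [tendsto_comap.eventually (eventually_lt_atBot 0)] with z hz
  exact (hconst z hz).symm

theorem quintic_identity {c : ℂ} (hc : c.re < 0) :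
    (divValue 0 6 c ^ 10 - 11 * divValue 0 3 c ^ 5 * divValue 0 6 c ^ 5 - divValue 0 3 c ^ 10) *
      thetaMoment 1 0 c ^ 4 = divValue 0 3 c ^ 11 * divValue 0 6 c ^ 11 := by
  have h3 := divValue_ne_zero hc (a := 3) (by norm_num) (by norm_num)
  have h6 := divValue_ne_zero hc (a := 6) (by norm_num) (by norm_num)
  have h := quinticQuot_eq_one hc
  unfold quinticQuot at h
  rw [div_eq_one_iff_eq (mul_ne_zero (pow_ne_zero 11 h3) (pow_ne_zero 11 h6))] at h
  rw [← h, mul_assoc 11]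

theorem divValue_eq_siegelProd {c : ℂ} (hc : c.re < 0) {a : ℕ} (h1 : 1 ≤ a) (h7 : a ≤ 7) :
    divValue 0 a c = -Complex.exp (c * (15 / 2 - a) ^ 2 / 225) *
      (expProd 1 c * siegelProd (Complex.exp (2 * c / 15)) a) := by
  unfold divValue
  rw [Int.cast_natCast, thetaMoment_div_fifteen hc (show a + (15 - a) = 15 by lia),
    siegelProd_eq_s11 hc h1 h7]

theorem siegelProd_ne_zero_s11 {c : ℂ} (hc : c.re < 0) {a : ℕ} (h1 : 1 ≤ a) (h7 : a ≤ 7) :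
    siegelProd (Complex.exp (2 * c / 15)) a ≠ 0 := by
  have h := divValue_ne_zero hc (a := a) (by lia) (by lia)
  rw [divValue_eq_siegelProd hc h1 h7] at h
  exact right_ne_zero_of_mul (right_ne_zero_of_mul h)

theorem unitU_eq {c τ : ℂ} (hcτ : c = 15 * π * Complex.I * τ) (hc : c.re < 0) :
    unitU τ = -(divValue 0 2 c * divValue 0 4 c / (divValue 0 1 c * divValue 0 7 c)) := by
  have e1 := divValue_eq_siegelProd hc (a := 1) (by norm_num) (by norm_num)
  have e2 := divValue_eq_siegelProd hc (a := 2) (by norm_num) (by norm_num)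
  have e4 := divValue_eq_siegelProd hc (a := 4) (by norm_num) (by norm_num)
  have e7 := divValue_eq_siegelProd hc (a := 7) (by norm_num) (by norm_num)
  have n1 := siegelProd_ne_zero_s11 hc (a := 1) (by norm_num) (by norm_num)
  have n7 := siegelProd_ne_zero_s11 hc (a := 7) (by norm_num) (by norm_num)
  have nE := expProd_ne_zero hc one_pos
  have he : Complex.exp (c * (15 / 2 - (2 : ℕ)) ^ 2 / 225) *
      Complex.exp (c * (15 / 2 - (4 : ℕ)) ^ 2 / 225) =
      Complex.exp (c * (15 / 2 - (1 : ℕ)) ^ 2 / 225) *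
      Complex.exp (c * (15 / 2 - (7 : ℕ)) ^ 2 / 225) := by
    rw [← Complex.exp_add, ← Complex.exp_add]
    congr 1
    push_cast
    ring
  unfold unitU
  rw [show 2 * (π : ℂ) * Complex.I * τ = 2 * c / 15 by rw [hcτ]; ring]
  have x1 := Complex.exp_ne_zero (c * (15 / 2 - (1 : ℕ)) ^ 2 / 225)
  have x7 := Complex.exp_ne_zero (c * (15 / 2 - (7 : ℕ)) ^ 2 / 225)
  push_cast at e1 e2 e4 e7 he x1 x7 nE
  rw [e1, e2, e4, e7, neg_inj, div_eq_div_iff (mul_ne_zero n1 n7) (by simp [x1, x7, n1, n7, nE])]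
  linear_combination (-siegelProd (Complex.exp (2 * c / 15)) 1 *
    siegelProd (Complex.exp (2 * c / 15)) 2 * siegelProd (Complex.exp (2 * c / 15)) 4 *
    siegelProd (Complex.exp (2 * c / 15)) 7 * expProd 1 c ^ 2) * he

theorem unitV_eq {c τ : ℂ} (hcτ : c = 15 * π * Complex.I * τ) (hc : c.re < 0) :
    unitV τ = -(divValue 0 4 c * divValue 0 7 c / (divValue 0 1 c * divValue 0 2 c)) := by
  have e1 := divValue_eq_siegelProd hc (a := 1) (by norm_num) (by norm_num)
  have e2 := divValue_eq_siegelProd hc (a := 2) (by norm_num) (by norm_num)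
  have e4 := divValue_eq_siegelProd hc (a := 4) (by norm_num) (by norm_num)
  have e7 := divValue_eq_siegelProd hc (a := 7) (by norm_num) (by norm_num)
  have n1 := siegelProd_ne_zero_s11 hc (a := 1) (by norm_num) (by norm_num)
  have n2 := siegelProd_ne_zero_s11 hc (a := 2) (by norm_num) (by norm_num)
  have nE := expProd_ne_zero hc one_pos
  have he : Complex.exp (c * (15 / 2 - (4 : ℕ)) ^ 2 / 225) *
      Complex.exp (c * (15 / 2 - (7 : ℕ)) ^ 2 / 225) =
      Complex.exp (2 * c / 15) ^ (-2 : ℤ) * Complex.exp (c * (15 / 2 - (1 : ℕ)) ^ 2 / 225) *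
      Complex.exp (c * (15 / 2 - (2 : ℕ)) ^ 2 / 225) := by
    rw [← Complex.exp_int_mul, ← Complex.exp_add, ← Complex.exp_add, ← Complex.exp_add]
    congr 1
    push_cast
    ring
  unfold unitV
  rw [show 2 * (π : ℂ) * Complex.I * τ = 2 * c / 15 by rw [hcτ]; ring]
  have x1 := Complex.exp_ne_zero (c * (15 / 2 - (1 : ℕ)) ^ 2 / 225)
  have x2 := Complex.exp_ne_zero (c * (15 / 2 - (2 : ℕ)) ^ 2 / 225)
  generalize Complex.exp (2 * c / 15) ^ (-2 : ℤ) = Z at *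
  push_cast at e1 e2 e4 e7 he x1 x2 nE
  rw [e1, e2, e4, e7, neg_inj, div_eq_div_iff (mul_ne_zero n1 n2) (by simp [x1, x2, n1, n2, nE])]
  linear_combination (-siegelProd (Complex.exp (2 * c / 15)) 1 *
    siegelProd (Complex.exp (2 * c / 15)) 2 * siegelProd (Complex.exp (2 * c / 15)) 4 *
    siegelProd (Complex.exp (2 * c / 15)) 7 * expProd 1 c ^ 2) * he

theorem re_mul_I_mul_neg {τ : ℂ} (hτ : 0 < τ.im) : (15 * π * Complex.I * τ).re < 0 := by
  have h : (15 * π * Complex.I * τ).re = -(15 * π * τ.im) := by simp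
  rw [h]
  have := mul_pos (mul_pos (by norm_num : (0 : ℝ) < 15) Real.pi_pos) hτ
  linarith

theorem hasDerivAt_divValue_quotient {c : ℂ} (hc : c.re < 0) :
    HasDerivAt (fun c => -(divValue 0 2 c * divValue 0 4 c / (divValue 0 1 c * divValue 0 7 c)))
      (-((divRatio 2 2 c + divRatio 2 4 c - divRatio 2 1 c - divRatio 2 7 c) *
        (divValue 0 2 c * divValue 0 4 c / (divValue 0 1 c * divValue 0 7 c)))) c := by
  have h1 := divValue_ne_zero hc (a := 1) (by norm_num) (by norm_num)
  have h2 := divValue_ne_zero hc (a := 2) (by norm_num) (by norm_num)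
  have h4 := divValue_ne_zero hc (a := 4) (by norm_num) (by norm_num)
  have h7 := divValue_ne_zero hc (a := 7) (by norm_num) (by norm_num)
  have d := (((hasDerivAt_divValue hc 0 2).mul (hasDerivAt_divValue hc 0 4)).div
    ((hasDerivAt_divValue hc 0 1).mul (hasDerivAt_divValue hc 0 7)) (mul_ne_zero h1 h7)).neg
  refine d.congr_deriv ?_
  simp only [Pi.mul_apply, zero_add, divValue_two_eq h1, divValue_two_eq h2, divValue_two_eq h4,
    divValue_two_eq h7]
  field_simp
  ring

theorem newform15_mul_eq {c τ : ℂ} (hcτ : c = 15 * π * Complex.I * τ) (hc : c.re < 0) :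
    newform15 τ * ((divValue 0 4 c / divValue 0 1 c + divValue 0 2 c / divValue 0 7 c) *
      (divValue 0 4 c / divValue 0 1 c * (divValue 0 2 c / divValue 0 7 c) - 1)) =
    15 / 2 * ((divRatio 2 2 c + divRatio 2 4 c - divRatio 2 1 c - divRatio 2 7 c) *
      (divValue 0 2 c * divValue 0 4 c / (divValue 0 1 c * divValue 0 7 c))) := by
  have h1 := divValue_ne_zero hc (a := 1) (by norm_num) (by norm_num)
  have h2 := divValue_ne_zero hc (a := 2) (by norm_num) (by norm_num)
  have h3 := divValue_ne_zero hc (a := 3) (by norm_num) (by norm_num)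
  have h4 := divValue_ne_zero hc (a := 4) (by norm_num) (by norm_num)
  have h6 := divValue_ne_zero hc (a := 6) (by norm_num) (by norm_num)
  have h7 := divValue_ne_zero hc (a := 7) (by norm_num) (by norm_num)
  obtain ⟨i₁, i₂, i₄⟩ := divValue_relations hc
  obtain ⟨e₃, e₆⟩ := divRatio_quintic_relations hc
  obtain ⟨e₁, r₁, r₂, r₄, r₈, p⟩ := divRatio_relations hc
  have hf := newform15_mul_sq hcτ hc
  have hdiv (a : ℤ) : divValue 0 a c = thetaMoment 0 (a / 15) c := rfl
  have key := log_deriv_identity h1 h2 h3 h4 h6 h7 (thetaMoment_one_zero_ne_zero hc) i₁ i₂ i₄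
    e₃ e₆ e₁ r₁ r₂ r₄ r₈ p (quintic_identity hc) (f := newform15 τ) (by
      simp only [hdiv, Int.cast_one, Int.cast_ofNat]
      exact hf)
  rw [← key]
  linear_combination (-3 / 2 * (divValue 0 2 c * divValue 0 4 c /
    (divValue 0 1 c * divValue 0 7 c))) * divRatio_two_combination hc

theorem two_mul_unit_identity {c τ : ℂ} (hcτ : c = 15 * π * Complex.I * τ) (hc : c.re < 0) :
    2 * (unitU τ + 1) ^ 2 * (unitV τ + 1) - unitU τ =
      -((divValue 0 4 c / divValue 0 1 c + divValue 0 2 c / divValue 0 7 c) *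
        (divValue 0 4 c / divValue 0 1 c * (divValue 0 2 c / divValue 0 7 c) - 1)) := by
  have h1 := divValue_ne_zero hc (a := 1) (by norm_num) (by norm_num)
  have h2 := divValue_ne_zero hc (a := 2) (by norm_num) (by norm_num)
  have h3 := divValue_ne_zero hc (a := 3) (by norm_num) (by norm_num)
  have h7 := divValue_ne_zero hc (a := 7) (by norm_num) (by norm_num)
  obtain ⟨i₁, i₂, -⟩ := divValue_relations hc
  rw [unitU_eq hcτ hc, unitV_eq hcτ hc]
  generalize divValue 0 1 c = a₁ at *
  generalize divValue 0 2 c = a₂ at *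
  generalize divValue 0 3 c = a₃ at *
  generalize divValue 0 4 c = a₄ at *
  generalize divValue 0 6 c = a₆ at *
  generalize divValue 0 7 c = a₇ at *
  have hC : (a₁ * a₂ - a₄ * a₇) * (a₁ * a₇ - a₂ * a₄) - a₁ * a₂ * a₄ * a₇ = 0 := by
    apply mul_left_cancel₀ h3
    linear_combination (a₁ * a₇ - a₂ * a₄) * i₂ - a₂ * a₇ * i₁
  field_simp
  linear_combination -(2 * (a₂ * a₄ - a₁ * a₇) + a₁ * a₂) * hC

/-- `u′(τ) = 2πi·f₁₅(τ)·(2(u(τ)+1)²(v(τ)+1) - u(τ))`; i.e. the invariant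
differential `ω_E = -dx/(2(x+1)²(y+1)-x)` pulls back under `τ ↦ (u(τ),v(τ))`
to `-2πi f₁₅(τ) dτ`. -/
theorem unitU_hasDerivAt (τ : ℂ) (hτ : 0 < τ.im) :
    HasDerivAt unitU
      (2 * (π : ℂ) * Complex.I * newform15 τ *
        (2 * (unitU τ + 1) ^ 2 * (unitV τ + 1) - unitU τ)) τ := by
  have hc := re_mul_I_mul_neg hτ
  have hlin : HasDerivAt (fun z : ℂ => 15 * π * Complex.I * z) (15 * π * Complex.I) τ := by
    simpa using (hasDerivAt_id τ).const_mul (15 * π * Complex.I : ℂ)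
  have d := (hasDerivAt_divValue_quotient hc).comp τ hlin
  have hev : unitU =ᶠ[𝓝 τ] (fun c => -(divValue 0 2 c * divValue 0 4 c /
      (divValue 0 1 c * divValue 0 7 c))) ∘ fun z : ℂ => 15 * π * Complex.I * z := by
    filter_upwards [(isOpen_lt continuous_const Complex.continuous_im).mem_nhds hτ] with z hz
    exact unitU_eq rfl (re_mul_I_mul_neg hz)
  refine (d.congr_of_eventuallyEq hev).congr_deriv ?_
  rw [two_mul_unit_identity rfl hc]
  linear_combination 2 * π * Complex.I * newform15_mul_eq rfl hc
end
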